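/- arXiv:1310.7771 — 2 statements merged into one kernel-verified Lean document; each statement's English description precedes it below -/
import Mathlib

section
/- Let M ∈ (0, 8π) and let (f_n) be a sequence of nonnegative integrable functions on ℝ² all of mass ∫ f_n dx = M, with uniformly bounded second moments sup_n ∫ f_n |x|² dx < ∞ and uniformly bounded free energy F(f_n) ≤ A for some A ∈ ℝ (all entropies and double-log integrals being absolutely convergnt), and suppose f_n converges to a function f in the sense of distributions, i.e. ∫ f_n φ dx → ∫ f φ dx for every smooth compactly supported test function φ. Then f is nonnegative with ∫ f dx = M and ∫ f |x|² dx < ∞, and F(f) ≤ liminf_n F(f_n), where F(h) := ∫_{ℝ²} h log h dx + (1/(4π)) ∬_{ℝ²×ℝ²} h(x) h(y) log|x−y| dx dy. -/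
open MeasureTheory Real Filter

noncomputable section

/-- The Keller–Segel free energy
`F(h) = ∫ h log h + (1/(4π)) ∬ h(x) h(y) log|x-y| dx dy`. -/
def freeEnergy (h : EuclideanSpace ℝ (Fin 2) → ℝ) : ℝ :=
  (∫ x, h x * Real.log (h x)) +
    (1 / (4 * π)) *
      ∫ q : EuclideanSpace ℝ (Fin 2) × EuclideanSpace ℝ (Fin 2),
        h q.1 * h q.2 * Real.log ‖q.1 - q.2‖

/-- the plane -/
abbrev KSE : Type := EuclideanSpace ℝ (Fin 2)

/-- Young's inequality for the entropy. -/
lemma ks_young (a t : ℝ) (ha : 0 ≤ a) : a * t ≤ a * Real.log a - a + Real.exp t := by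
  rcases ha.eq_or_lt with h | h
  · subst h; simp; positivity
  · have h1 := Real.add_one_le_exp (t - Real.log a)
    rw [Real.exp_sub, Real.exp_log h] at h1
    have h2 : a * (t - Real.log a + 1) ≤ a * (Real.exp t / a) :=
      mul_le_mul_of_nonneg_left h1 ha
    rw [mul_div_cancel₀ _ h.ne'] at h2
    linarith

/-- integrable weight -/
def ksw (x : KSE) : ℝ := (1 + ‖x‖) ^ (-(3:ℝ))

lemma ksw_pos (x : KSE) : 0 < ksw x := by unfold ksw; positivity

lemma ksw_le_one (x : KSE) : ksw x ≤ 1 := by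
  unfold ksw
  apply Real.rpow_le_one_of_one_le_of_nonpos <;> linarith [norm_nonneg x]

lemma ksw_log (x : KSE) : Real.log (ksw x) = -3 * Real.log (1 + ‖x‖) := by
  unfold ksw; rw [Real.log_rpow (by positivity)]

lemma ksw_log_nonpos (x : KSE) : Real.log (ksw x) ≤ 0 :=
  Real.log_nonpos (ksw_pos x).le (ksw_le_one x)

lemma ksw_log_ge (x : KSE) : -(3 * ‖x‖) ≤ Real.log (ksw x) := by
  rw [ksw_log]
  have := Real.log_le_sub_one_of_pos (x := 1 + ‖x‖) (by positivity)
  linarith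

lemma ksw_cont : Continuous ksw := by
  unfold ksw
  apply Continuous.rpow_const (by fun_prop)
  intro x; left; positivity

lemma ksw_log_cont : Continuous (fun x => Real.log (ksw x)) :=
  ksw_cont.log (fun x => (ksw_pos x).ne')

lemma ksw_int : Integrable ksw := by
  apply integrable_one_add_norm
  simp; norm_num

/-- truncated singular kernel -/
def ksj (l e : ℝ) (z : KSE) : ℝ :=
  (Metric.ball (0:KSE) e).indicator (fun z => Real.exp (-l * Real.log ‖z‖)) z

lemma ksj_nonneg (l e : ℝ) (z : KSE) : 0 ≤ ksj l e z :=
  Set.indicator_nonneg (fun _ _ => (Real.exp_pos _).le) _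

lemma ksj_neg (l e : ℝ) (z : KSE) : ksj l e (-z) = ksj l e z := by
  unfold ksj; simp [Set.indicator, Metric.mem_ball]

lemma ksj_meas (l : ℝ) : Measurable (fun z : KSE => Real.exp (-l * Real.log ‖z‖)) := by
  fun_prop

lemma ksj_int (l e : ℝ) (hl : l < 2) : Integrable (ksj l e) := by
  unfold ksj
  change Integrable ((Metric.ball (0:KSE) e).indicator (fun z => Real.exp (-l * Real.log ‖z‖)))
  rw [integrable_indicator_iff measurableSet_ball]
  apply integrableOn_ball_of_norm_le_rpow (C := 1) (α := l) (by simp) (by simpa using hl)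
  · apply ae_restrict_of_ae
    have h0 : ∀ᵐ x : KSE, x ≠ 0 := by
      simp [ae_iff]
    filter_upwards [h0] with x hx
    rw [Real.norm_of_nonneg (Real.exp_pos _).le, one_mul,
      Real.rpow_def_of_pos (norm_pos_iff.mpr hx)]
    apply le_of_eq; ring_nf
  · exact (ksj_meas l).aestronglyMeasurable

lemma ksj_tendsto (l : ℝ) (hl : l < 2) :
    Tendsto (fun n : ℕ => ∫ z, ksj l (1 / ((n:ℝ) + 2)) z) atTop (nhds 0) := by
  have h0 : ∀ᵐ x : KSE, x ≠ 0 := by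
    simp [ae_iff]
  have : (0:ℝ) = ∫ z : KSE, (0:ℝ) := by simp
  rw [this]
  apply tendsto_integral_of_dominated_convergence (ksj l 1)
  · intro n
    exact ((ksj_meas l).indicator measurableSet_ball).aestronglyMeasurable
  · exact ksj_int l 1 hl
  · intro n
    apply Eventually.of_forall
    intro z
    rw [Real.norm_of_nonneg (ksj_nonneg _ _ _)]
    unfold ksj
    apply Set.indicator_le_indicator_of_subset
    · apply Metric.ball_subset_ball
      rw [div_le_one (by positivity)]
      have : (0:ℝ) ≤ n := by positivity
      linarith
    · intro _; positivity
  · filter_upwards [h0] with z hz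
    have hz' : 0 < ‖z‖ := norm_pos_iff.mpr hz
    obtain ⟨N, hN⟩ := exists_nat_gt (1 / ‖z‖)
    apply tendsto_const_nhds.congr'
    filter_upwards [eventually_ge_atTop N] with n hn
    unfold ksj
    rw [Set.indicator_of_notMem]
    simp only [Metric.mem_ball, dist_zero_right, not_lt]
    have h1 : (N:ℝ) ≤ n := by exact_mod_cast hn
    have h2 : 1 / ‖z‖ < (n:ℝ) + 2 := by linarith
    rw [div_lt_iff₀ hz'] at h2
    rw [div_le_iff₀ (by positivity)]
    linarith

lemma ks_conv {f g : KSE → ℝ} (hf : Integrable f) (hg : Integrable g) :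
    Integrable (fun q : KSE × KSE => f q.2 * g (q.1 - q.2)) ∧
      ∫ q : KSE × KSE, f q.2 * g (q.1 - q.2) = (∫ x, f x) * ∫ x, g x := by
  have h1 : Integrable (fun q : KSE × KSE => f q.2 * g (q.1 - q.2)) := by
    have := hf.convolution_integrand (ContinuousLinearMap.mul ℝ ℝ) hg
    exact this
  refine ⟨h1, ?_⟩
  rw [Measure.volume_eq_prod, integral_prod_symm _ h1]
  simp only [integral_const_mul]
  have : ∀ y : KSE, ∫ x, g (x - y) = ∫ x, g x := fun y => integral_sub_right_eq_self g y
  simp_rw [this, integral_mul_const]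

lemma ks_conv' {f g : KSE → ℝ} (hf : Integrable f) (hg : Integrable g)
    (hs : ∀ z, g (-z) = g z) :
    Integrable (fun q : KSE × KSE => f q.1 * g (q.1 - q.2)) ∧
      ∫ q : KSE × KSE, f q.1 * g (q.1 - q.2) = (∫ x, f x) * ∫ x, g x := by
  obtain ⟨h1, h2⟩ := ks_conv hf hg
  have e : (fun q : KSE × KSE => f q.1 * g (q.1 - q.2)) =
      (fun q : KSE × KSE => f q.2 * g (q.1 - q.2)) ∘ Prod.swap := by
    funext q
    simp only [Function.comp, Prod.fst_swap, Prod.snd_swap]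
    rw [← hs (q.1 - q.2), neg_sub]
  constructor
  · rw [e]; exact h1.swap
  · rw [e, ← h2]
    exact integral_prod_swap (fun q : KSE × KSE => f q.2 * g (q.1 - q.2))

lemma ks_diag : ∀ᵐ q : KSE × KSE, q.1 - q.2 ≠ 0 := by
  have h0 : ∀ᵐ x : KSE, x ≠ 0 := by
    simp [ae_iff]
  exact (quasiMeasurePreserving_sub_of_right_invariant volume volume).ae h0

/-- regularity bundle -/
structure KSGood (f : KSE → ℝ) : Prop where
  nonneg : ∀ x, 0 ≤ f x
  int : Integrable f
  m2 : Integrable (fun x => f x * ‖x‖ ^ 2)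
  ent : Integrable (fun x => f x * Real.log (f x))

lemma ks_norm_le (x : KSE) : ‖x‖ ≤ 1 + ‖x‖ ^ 2 := by nlinarith [sq_nonneg (‖x‖ - 1)]

lemma KSGood.m2' {f : KSE → ℝ} (h : KSGood f) : Integrable (fun x => f x * (1 + ‖x‖ ^ 2)) := by
  have := h.int.add h.m2
  refine this.congr (Eventually.of_forall fun x => ?_)
  simp only [Pi.add_apply]; ring

lemma ks_log_meas : Measurable (fun q : KSE × KSE => Real.log ‖q.1 - q.2‖) := by
  fun_prop

lemma KSGood.dbl {f : KSE → ℝ} (h : KSGood f) :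
    Integrable (fun q : KSE × KSE => f q.1 * f q.2 * Real.log ‖q.1 - q.2‖) := by
  have hA : Integrable (fun q : KSE × KSE => (f q.1 * (1 + ‖q.1‖ ^ 2)) * f q.2) :=
    h.m2'.mul_prod h.int
  have hB : Integrable (fun q : KSE × KSE => f q.1 * (f q.2 * (1 + ‖q.2‖ ^ 2))) :=
    h.int.mul_prod h.m2'
  have hC : Integrable (fun q : KSE × KSE => |f q.1 * Real.log (f q.1)| * f q.2) :=
    h.ent.abs.mul_prod h.int
  have hD := (ks_conv h.int (ksj_int 1 1 (by norm_num))).1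
  apply (((hA.add hB).add hC).add hD).mono'
  · exact (h.int.aestronglyMeasurable.comp_fst.mul
      h.int.aestronglyMeasurable.comp_snd).mul ks_log_meas.aestronglyMeasurable
  · apply Eventually.of_forall
    rintro ⟨x, y⟩
    simp only [Pi.add_apply]
    have hx := h.nonneg x
    have hy := h.nonneg y
    have hj := ksj_nonneg 1 1 (x - y)
    rw [norm_mul, Real.norm_of_nonneg (mul_nonneg hx hy), Real.norm_eq_abs]
    rcases le_or_gt 1 ‖x - y‖ with h1 | h1
    · rw [abs_of_nonneg (Real.log_nonneg h1)]
      have h2 : Real.log ‖x - y‖ ≤ (1 + ‖x‖ ^ 2) + (1 + ‖y‖ ^ 2) := by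
        have := Real.log_le_sub_one_of_pos (x := ‖x - y‖) (by linarith)
        have := norm_sub_le x y
        have := ks_norm_le x
        have := ks_norm_le y
        linarith
      have h3 := mul_le_mul_of_nonneg_left h2 (mul_nonneg hx hy)
      have h4 : 0 ≤ |f x * Real.log (f x)| * f y := mul_nonneg (abs_nonneg _) hy
      have h5 : 0 ≤ f y * ksj 1 1 (x - y) := mul_nonneg hy hj
      nlinarith
    · have hs : Real.log ‖x - y‖ ≤ 0 := Real.log_nonpos (norm_nonneg _) h1.le
      rw [abs_of_nonpos hs]
      have h2 := ks_young (f x) (-Real.log ‖x - y‖) hx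
      have h3 : ksj 1 1 (x - y) = Real.exp (-Real.log ‖x - y‖) := by
        unfold ksj
        rw [Set.indicator_of_mem (by simpa using h1)]
        simp
      have h4 : f x * (-Real.log ‖x - y‖) ≤ |f x * Real.log (f x)| + ksj 1 1 (x - y) := by
        rw [h3]; linarith [le_abs_self (f x * Real.log (f x))]
      have h5 := mul_le_mul_of_nonneg_left h4 hy
      have h6 : 0 ≤ f x * (1 + ‖x‖ ^ 2) * f y := by positivity
      have h7 : 0 ≤ f x * (f y * (1 + ‖y‖ ^ 2)) := by positivity
      nlinarith

lemma KSGood.lw {f : KSE → ℝ} (h : KSGood f) : Integrable (fun x => f x * Real.log (ksw x)) := by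
  apply (h.m2'.const_mul 3).mono'
  · exact h.int.aestronglyMeasurable.mul ksw_log_cont.aestronglyMeasurable
  · apply Eventually.of_forall
    intro x
    rw [norm_mul, Real.norm_of_nonneg (h.nonneg x), Real.norm_eq_abs,
      abs_of_nonpos (ksw_log_nonpos x)]
    have h1 : -Real.log (ksw x) ≤ 3 * (1 + ‖x‖ ^ 2) := by
      linarith [ksw_log_ge x, ks_norm_le x]
    have := mul_le_mul_of_nonneg_left h1 (h.nonneg x)
    linarith

lemma KSGood.lw_ge {f : KSE → ℝ} (h : KSGood f) :
    -(3 * ((∫ x, f x) + ∫ x, f x * ‖x‖ ^ 2)) ≤ ∫ x, f x * Real.log (ksw x) := by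
  have e : (∫ x, f x) + ∫ x, f x * ‖x‖ ^ 2 = ∫ x, f x * (1 + ‖x‖ ^ 2) := by
    rw [← integral_add h.int h.m2]
    congr 1; funext x; ring
  rw [e, ← integral_const_mul, ← integral_neg]
  apply integral_mono (h.m2'.const_mul 3).neg h.lw
  intro x
  simp only [Pi.add_apply, Pi.sub_apply, Pi.neg_apply]
  have h1 : -(3 * (1 + ‖x‖ ^ 2)) ≤ Real.log (ksw x) := by
    linarith [ksw_log_ge x, ks_norm_le x]
  have := mul_le_mul_of_nonneg_left h1 (h.nonneg x)
  linarith

/-- subcritical log-HLS -/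
lemma KSGood.hls {f : KSE → ℝ} (h : KSGood f) {l : ℝ} (hl0 : 0 < l) (hl : l < 2) :
    -l * (∫ q : KSE × KSE, f q.1 * f q.2 * Real.log ‖q.1 - q.2‖) ≤
      (∫ x, f x) * ((∫ x, f x * Real.log (f x)) +
        3 * ((∫ x, f x) + ∫ x, f x * ‖x‖ ^ 2) + (∫ x, ksw x) + ∫ z, ksj l 1 z) := by
  set M := ∫ x, f x with hM
  have hM0 : 0 ≤ M := integral_nonneg h.nonneg
  obtain ⟨hD, hD'⟩ := ks_conv h.int (ksj_int l 1 hl)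
  have hG : Integrable (fun x => f x * Real.log (f x) - f x * Real.log (ksw x) + ksw x) :=
    (h.ent.sub h.lw).add ksw_int
  have hA : Integrable (fun q : KSE × KSE =>
      (f q.1 * Real.log (f q.1) - f q.1 * Real.log (ksw q.1) + ksw q.1) * f q.2) :=
    hG.mul_prod h.int
  have hA' : ∫ q : KSE × KSE,
      (f q.1 * Real.log (f q.1) - f q.1 * Real.log (ksw q.1) + ksw q.1) * f q.2
      = ((∫ x, f x * Real.log (f x)) - (∫ x, f x * Real.log (ksw x)) + ∫ x, ksw x) * M := by
    have := integral_prod_mul (μ := (volume : Measure KSE)) (ν := (volume : Measure KSE))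
      (fun x => f x * Real.log (f x) - f x * Real.log (ksw x) + ksw x) f
    have hs : Integrable (fun x => f x * Real.log (f x) - f x * Real.log (ksw x)) :=
      h.ent.sub h.lw
    rw [Measure.volume_eq_prod, this, integral_add hs ksw_int,
      integral_sub h.ent h.lw]
  have key : ∫ q : KSE × KSE, -l * (f q.1 * f q.2 * Real.log ‖q.1 - q.2‖) ≤
      ∫ q : KSE × KSE,
        ((f q.1 * Real.log (f q.1) - f q.1 * Real.log (ksw q.1) + ksw q.1) * f q.2
          + f q.2 * ksj l 1 (q.1 - q.2)) := by
    apply integral_mono (h.dbl.const_mul _) (hA.add hD)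
    rintro ⟨x, y⟩
    simp only [Pi.add_apply, Pi.sub_apply, Pi.neg_apply]
    have hx := h.nonneg x
    have hy := h.nonneg y
    have h1 := ks_young (f x) (-l * Real.log ‖x - y‖ + Real.log (ksw x)) hx
    rw [Real.exp_add, Real.exp_log (ksw_pos x)] at h1
    have h2 : Real.exp (-l * Real.log ‖x - y‖) * ksw x ≤ ksw x + ksj l 1 (x - y) := by
      have hw := ksw_pos x
      have hw1 := ksw_le_one x
      have he := Real.exp_pos (-l * Real.log ‖x - y‖)
      rcases le_or_gt 1 ‖x - y‖ with h1 | h1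
      · have : Real.exp (-l * Real.log ‖x - y‖) ≤ 1 := by
          rw [Real.exp_le_one_iff]
          have := Real.log_nonneg h1
          nlinarith
        have := ksj_nonneg l 1 (x - y)
        nlinarith
      · have h3 : ksj l 1 (x - y) = Real.exp (-l * Real.log ‖x - y‖) := by
          unfold ksj
          rw [Set.indicator_of_mem (by simpa using h1)]
        rw [h3]
        nlinarith
    have h3 : f x * (-l * Real.log ‖x - y‖) ≤
        f x * Real.log (f x) - f x * Real.log (ksw x) + ksw x + ksj l 1 (x - y) := by
      linarith
    have h4 := mul_le_mul_of_nonneg_left h3 hy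
    linarith
  rw [integral_const_mul, integral_add hA hD, hA', hD', ← hM] at key
  refine key.trans ?_
  have := h.lw_ge
  nlinarith

lemma KSGood.ent_ge {f : KSE → ℝ} (h : KSGood f) :
    -(3 * ((∫ x, f x) + ∫ x, f x * ‖x‖ ^ 2)) - (∫ x, ksw x) ≤ ∫ x, f x * Real.log (f x) := by
  have h1 : ∫ x, (f x * Real.log (ksw x) - ksw x) ≤ ∫ x, f x * Real.log (f x) := by
    apply integral_mono (h.lw.sub ksw_int) h.ent
    intro x
    simp only [Pi.add_apply, Pi.sub_apply, Pi.neg_apply]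
    have := ks_young (f x) (Real.log (ksw x)) (h.nonneg x)
    rw [Real.exp_log (ksw_pos x)] at this
    linarith [h.nonneg x]
  rw [integral_sub h.lw ksw_int] at h1
  linarith [h.lw_ge]

lemma KSGood.abs_ent_le {f : KSE → ℝ} (h : KSGood f) :
    (∫ x, |f x * Real.log (f x)|) ≤ (∫ x, f x * Real.log (f x)) +
      2 * (3 * ((∫ x, f x) + ∫ x, f x * ‖x‖ ^ 2) + (∫ x, ksw x)) := by
  have h1 : ∫ x, |f x * Real.log (f x)| ≤
      ∫ x, (f x * Real.log (f x) + 2 * (ksw x - f x * Real.log (ksw x))) := by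
    apply integral_mono h.ent.abs (h.ent.add ((ksw_int.sub h.lw).const_mul 2))
    intro x
    simp only [Pi.add_apply, Pi.sub_apply, Pi.neg_apply]
    have := ks_young (f x) (Real.log (ksw x)) (h.nonneg x)
    rw [Real.exp_log (ksw_pos x)] at this
    have h2 := mul_nonneg (h.nonneg x) (neg_nonneg.mpr (ksw_log_nonpos x))
    have h3 := ksw_pos x
    apply abs_le.mpr
    constructor <;> linarith [h.nonneg x]
  have hs : Integrable (fun x => 2 * (ksw x - f x * Real.log (ksw x))) :=
    (ksw_int.sub h.lw).const_mul 2
  rw [integral_add h.ent hs, integral_const_mul,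
    integral_sub ksw_int h.lw] at h1
  linarith [h.lw_ge]

/-- truncated kernel -/
def ksL (e : ℝ) (z : KSE) : ℝ := Real.log (max ‖z‖ e)

lemma ksL_cont {e : ℝ} (he : 0 < e) : Continuous (ksL e) := by
  unfold ksL
  apply Continuous.log (by fun_prop)
  intro x
  have : e ≤ max ‖x‖ e := le_max_right _ _
  linarith

/-- short-range part, pointwise -/
lemma ks_short_ptw {a b e K : ℝ} (ha : 0 ≤ a) (hb : 0 ≤ b) (he : 0 < e) (he1 : e ≤ 1)
    (hK : 1 < K) (z : KSE) :
    a * b * (ksL e z - Real.log ‖z‖) ≤ K * (b * ksj 1 e z) + K * (a * ksj 1 e z) +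
      (1 / Real.log K) * (|a * Real.log a| * |b * Real.log b| + |b * Real.log b| * ksj 1 e z) := by
  have hj := ksj_nonneg 1 e z
  have hlK : 0 < Real.log K := Real.log_pos hK
  have hR1 : 0 ≤ K * (b * ksj 1 e z) := by positivity
  have hR2 : 0 ≤ K * (a * ksj 1 e z) := by positivity
  have hR3 : 0 ≤ (1 / Real.log K) *
      (|a * Real.log a| * |b * Real.log b| + |b * Real.log b| * ksj 1 e z) := by positivity
  rcases le_or_gt e ‖z‖ with h1 | h1
  · have : ksL e z = Real.log ‖z‖ := by unfold ksL; rw [max_eq_left h1]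
    rw [this]; simp only [sub_self, mul_zero]; linarith
  · have hL : ksL e z ≤ 0 := by
      unfold ksL; rw [max_eq_right h1.le]; exact Real.log_nonpos he.le he1
    set s := -Real.log ‖z‖ with hs
    have hj' : ksj 1 e z = Real.exp s := by
      unfold ksj
      rw [Set.indicator_of_mem (by simpa using h1), hs]; simp
    have hs0 : 0 ≤ s := by
      have := Real.log_nonpos (norm_nonneg z) (h1.le.trans he1)
      linarith
    have hsj : s ≤ ksj 1 e z := by
      rw [hj']; linarith [Real.add_one_le_exp s]
    have h0 : a * b * (ksL e z - Real.log ‖z‖) ≤ a * b * s :=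
      mul_le_mul_of_nonneg_left (by linarith) (mul_nonneg ha hb)
    refine h0.trans ?_
    rcases le_or_gt a K with haK | haK
    · have : a * b * s ≤ K * (b * ksj 1 e z) := by
        rw [mul_assoc]
        apply mul_le_mul haK (mul_le_mul_of_nonneg_left hsj hb) (by positivity) (by linarith)
      linarith
    rcases le_or_gt b K with hbK | hbK
    · have : a * b * s ≤ K * (a * ksj 1 e z) := by
        rw [mul_comm a b, mul_assoc]
        apply mul_le_mul hbK (mul_le_mul_of_nonneg_left hsj ha) (by positivity) (by linarith)
      linarith
    · have h2 := ks_young a s ha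
      rw [← hj'] at h2
      have h3 : a * s ≤ |a * Real.log a| + ksj 1 e z := by
        linarith [le_abs_self (a * Real.log a)]
      have h4 : b ≤ (1 / Real.log K) * |b * Real.log b| := by
        have : Real.log K ≤ Real.log b := Real.log_le_log (by linarith) hbK.le
        rw [abs_of_nonneg (by nlinarith), one_div, ← div_eq_inv_mul, le_div_iff₀ hlK]
        nlinarith
      have h5 : b * (a * s) ≤ ((1 / Real.log K) * |b * Real.log b|) *
          (|a * Real.log a| + ksj 1 e z) :=
        mul_le_mul h4 h3 (by positivity) (by positivity)
      have h6 : a * b * s = b * (a * s) := by ring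
      have h7 : ((1 / Real.log K) * |b * Real.log b|) * (|a * Real.log a| + ksj 1 e z) =
        (1 / Real.log K) *
          (|a * Real.log a| * |b * Real.log b| + |b * Real.log b| * ksj 1 e z) := by ring
      linarith

lemma KSGood.dblL {f : KSE → ℝ} (h : KSGood f) {e N : ℝ} (he : 0 < e) :
    Integrable (fun q : KSE × KSE => f q.1 * f q.2 * min (ksL e (q.1 - q.2)) N) := by
  have hc : Continuous (fun q : KSE × KSE => min (ksL e (q.1 - q.2)) N) :=
    ((ksL_cont he).comp (by fun_prop)).min continuous_const
  have hff : Integrable (fun q : KSE × KSE => f q.1 * f q.2) := h.int.mul_prod h.int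
  refine hff.mul_bdd (c := max |N| |Real.log e|) hc.aestronglyMeasurable
    (Eventually.of_forall fun q => ?_)
  have h1 : Real.log e ≤ ksL e (q.1 - q.2) := Real.log_le_log he (le_max_right _ _)
  have h2 := le_max_left |N| |Real.log e|
  have h3 := le_max_right |N| |Real.log e|
  rw [Real.norm_eq_abs, abs_le]
  constructor
  · apply le_min
    · linarith [neg_abs_le (Real.log e)]
    · linarith [neg_abs_le N]
  · exact (min_le_right _ _).trans ((le_abs_self N).trans h2)

lemma KSGood.short {f : KSE → ℝ} (h : KSGood f) {e K N : ℝ} (he : 0 < e) (he1 : e ≤ 1)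
    (hK : 1 < K) :
    (∫ q : KSE × KSE, f q.1 * f q.2 * min (ksL e (q.1 - q.2)) N) -
      (∫ q : KSE × KSE, f q.1 * f q.2 * Real.log ‖q.1 - q.2‖) ≤
      2 * K * ((∫ x, f x) * ∫ z, ksj 1 e z) + (1 / Real.log K) *
        ((∫ x, |f x * Real.log (f x)|) ^ 2 + (∫ x, |f x * Real.log (f x)|) * ∫ z, ksj 1 e z) := by
  have hji := ksj_int 1 e (by norm_num)
  obtain ⟨i1, e1⟩ := ks_conv h.int hji
  obtain ⟨i2, e2⟩ := ks_conv' h.int hji (ksj_neg 1 e)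
  obtain ⟨i3, e3⟩ := ks_conv h.ent.abs hji
  have i4 : Integrable (fun q : KSE × KSE =>
      |f q.1 * Real.log (f q.1)| * |f q.2 * Real.log (f q.2)|) := h.ent.abs.mul_prod h.ent.abs
  have e4 : ∫ q : KSE × KSE, |f q.1 * Real.log (f q.1)| * |f q.2 * Real.log (f q.2)| =
      (∫ x, |f x * Real.log (f x)|) * ∫ x, |f x * Real.log (f x)| :=
    integral_prod_mul (μ := (volume : Measure KSE)) (ν := (volume : Measure KSE))
      (fun x => |f x * Real.log (f x)|) (fun x => |f x * Real.log (f x)|)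
  rw [← integral_sub (h.dblL he) h.dbl]
  have key : ∫ q : KSE × KSE, (f q.1 * f q.2 * min (ksL e (q.1 - q.2)) N -
      f q.1 * f q.2 * Real.log ‖q.1 - q.2‖) ≤
      ∫ q : KSE × KSE, (K * (f q.2 * ksj 1 e (q.1 - q.2)) + K * (f q.1 * ksj 1 e (q.1 - q.2)) +
      (1 / Real.log K) * (|f q.1 * Real.log (f q.1)| * |f q.2 * Real.log (f q.2)| +
        |f q.2 * Real.log (f q.2)| * ksj 1 e (q.1 - q.2))) := by
    apply integral_mono ((h.dblL he).sub h.dbl)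
      (((i1.const_mul K).add (i2.const_mul K)).add ((i4.add i3).const_mul _))
    rintro ⟨x, y⟩
    simp only [Pi.add_apply, Pi.sub_apply, Pi.neg_apply]
    have h1 := ks_short_ptw (h.nonneg x) (h.nonneg y) he he1 hK (x - y)
    have h2 : f x * f y * min (ksL e (x - y)) N ≤ f x * f y * ksL e (x - y) :=
      mul_le_mul_of_nonneg_left (min_le_left _ _) (mul_nonneg (h.nonneg x) (h.nonneg y))
    linarith
  have s1 : Integrable (fun q : KSE × KSE => K * (f q.2 * ksj 1 e (q.1 - q.2)) +
      K * (f q.1 * ksj 1 e (q.1 - q.2))) := (i1.const_mul K).add (i2.const_mul K)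
  have s2 : Integrable (fun q : KSE × KSE => (1 / Real.log K) *
      (|f q.1 * Real.log (f q.1)| * |f q.2 * Real.log (f q.2)| +
        |f q.2 * Real.log (f q.2)| * ksj 1 e (q.1 - q.2))) := (i4.add i3).const_mul _
  rw [integral_add s1 s2,
    integral_add (i1.const_mul K) (i2.const_mul K), integral_const_mul, integral_const_mul,
    integral_const_mul, integral_add i4 i3, e1, e2, e3, e4] at key
  refine key.trans (le_of_eq ?_)
  ring

/-- upper truncation removal for the limit -/
lemma KSGood.trunc {f : KSE → ℝ} (h : KSGood f) {e : ℝ} (he : 0 < e) {d : ℝ} (hd : 0 < d) :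
    ∃ N : ℝ, (∫ q : KSE × KSE, f q.1 * f q.2 * Real.log ‖q.1 - q.2‖) ≤
      (∫ q : KSE × KSE, f q.1 * f q.2 * min (ksL e (q.1 - q.2)) N) + d := by
  have ht : Tendsto (fun n : ℕ => ∫ q : KSE × KSE,
      f q.1 * f q.2 * min (Real.log ‖q.1 - q.2‖) n) atTop
      (nhds (∫ q : KSE × KSE, f q.1 * f q.2 * Real.log ‖q.1 - q.2‖)) := by
    apply tendsto_integral_of_dominated_convergence
      (fun q : KSE × KSE => ‖f q.1 * f q.2 * Real.log ‖q.1 - q.2‖‖)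
    · intro n
      exact (h.int.aestronglyMeasurable.comp_fst.mul
        h.int.aestronglyMeasurable.comp_snd).mul
          (ks_log_meas.min measurable_const).aestronglyMeasurable
    · exact h.dbl.norm
    · intro n
      apply Eventually.of_forall
      intro q
      rw [norm_mul, norm_mul (f q.1 * f q.2)]
      apply mul_le_mul_of_nonneg_left _ (norm_nonneg _)
      rw [Real.norm_eq_abs, Real.norm_eq_abs]
      have hn : (0:ℝ) ≤ n := by positivity
      rcases le_total (Real.log ‖q.1 - q.2‖) n with h1 | h1
      · rw [min_eq_left h1]
      · rw [min_eq_right h1, abs_of_nonneg hn, abs_of_nonneg (hn.trans h1)]; exact h1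
    · apply Eventually.of_forall
      intro q
      apply tendsto_const_nhds.congr'
      obtain ⟨N, hN⟩ := exists_nat_gt (Real.log ‖q.1 - q.2‖)
      filter_upwards [eventually_ge_atTop N] with n hn
      have : (N:ℝ) ≤ n := by exact_mod_cast hn
      rw [min_eq_left (by linarith)]
  have h1 := ht.eventually (eventually_gt_nhds (b := (∫ q : KSE × KSE,
    f q.1 * f q.2 * Real.log ‖q.1 - q.2‖) - d) (by linarith))
  obtain ⟨n, hn⟩ := h1.exists
  refine ⟨n, ?_⟩
  have h2 : ∫ q : KSE × KSE, f q.1 * f q.2 * min (Real.log ‖q.1 - q.2‖) n ≤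
      ∫ q : KSE × KSE, f q.1 * f q.2 * min (ksL e (q.1 - q.2)) n := by
    by_cases hi : Integrable (fun q : KSE × KSE => f q.1 * f q.2 * min (Real.log ‖q.1 - q.2‖) n)
    · apply integral_mono_ae hi (h.dblL he)
      filter_upwards [ks_diag] with q hq
      apply mul_le_mul_of_nonneg_left _ (mul_nonneg (h.nonneg _) (h.nonneg _))
      apply min_le_min_right
      exact Real.log_le_log (norm_pos_iff.mpr hq) (le_max_left _ _)
    · exfalso
      apply hi
      apply h.dbl.mono
      · exact (h.int.aestronglyMeasurable.comp_fst.mul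
          h.int.aestronglyMeasurable.comp_snd).mul
            (ks_log_meas.min measurable_const).aestronglyMeasurable
      · apply Eventually.of_forall
        intro q
        rw [norm_mul, norm_mul (f q.1 * f q.2)]
        apply mul_le_mul_of_nonneg_left _ (norm_nonneg _)
        rw [Real.norm_eq_abs, Real.norm_eq_abs]
        have hn : (0:ℝ) ≤ n := by positivity
        rcases le_total (Real.log ‖q.1 - q.2‖) n with h1 | h1
        · rw [min_eq_left h1]
        · rw [min_eq_right h1, abs_of_nonneg hn, abs_of_nonneg (hn.trans h1)]; exact h1
  linarith

lemma ks_fatou {G : ℕ → KSE → ℝ} {G' : KSE → ℝ} {C : ℝ} (h0 : ∀ k, ∀ x, 0 ≤ G k x)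
    (hi : ∀ k, Integrable (G k)) (hC : ∀ k, ∫ x, G k x ≤ C)
    (ht : ∀ᵐ x, Tendsto (fun k => G k x) atTop (nhds (G' x))) :
    Integrable G' ∧ ∫ x, G' x ≤ C := by
  have hC0 : 0 ≤ C := (integral_nonneg (h0 0)).trans (hC 0)
  have hm : AEStronglyMeasurable G' volume :=
    aestronglyMeasurable_of_tendsto_ae atTop (fun k => (hi k).aestronglyMeasurable) ht
  have hn : 0 ≤ᵐ[volume] G' := by
    filter_upwards [ht] with x hx
    exact ge_of_tendsto' hx (fun k => h0 k x)
  have hl : ∫⁻ x, ENNReal.ofReal (G' x) ≤ ENNReal.ofReal C := by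
    calc ∫⁻ x, ENNReal.ofReal (G' x)
        = ∫⁻ x, liminf (fun k => ENNReal.ofReal (G k x)) atTop := by
          apply lintegral_congr_ae
          filter_upwards [ht] with x hx
          exact ((ENNReal.continuous_ofReal.tendsto _).comp hx).liminf_eq.symm
      _ ≤ liminf (fun k => ∫⁻ x, ENNReal.ofReal (G k x)) atTop :=
          lintegral_liminf_le' (fun k => (hi k).aemeasurable.ennreal_ofReal)
      _ ≤ ENNReal.ofReal C := by
          apply liminf_le_of_frequently_le'
          apply Frequently.of_forall
          intro k
          rw [← ofReal_integral_eq_lintegral_ofReal (hi k) (Eventually.of_forall (h0 k))]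
          exact ENNReal.ofReal_le_ofReal (hC k)
  have hint : Integrable G' := by
    refine ⟨hm, ?_⟩
    rw [hasFiniteIntegral_iff_ofReal hn]
    exact hl.trans_lt ENNReal.ofReal_lt_top
  refine ⟨hint, ?_⟩
  rw [← ofReal_integral_eq_lintegral_ofReal hint hn] at hl
  exact (ENNReal.ofReal_le_ofReal_iff hC0).mp hl

/-- cutoff -/
def ksc (R : ℝ) (hR : 0 < R) : ContDiffBump (0 : KSE) := ⟨R, R + 1, hR, by linarith⟩

lemma ksc_one {R : ℝ} (hR : 0 < R) {x : KSE} (hx : ‖x‖ ≤ R) : ksc R hR x = 1 :=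
  (ksc R hR).one_of_mem_closedBall (by simpa [ksc] using hx)

lemma ks_bdd_mul {g φ : KSE → ℝ} (hg : Integrable g) (hφ : Continuous φ)
    (hb : ∃ C, ∀ x, |φ x| ≤ C) : Integrable (fun x => g x * φ x) := by
  obtain ⟨C, hC⟩ := hb
  exact hg.mul_bdd (c := C) hφ.aestronglyMeasurable (Eventually.of_forall hC)

lemma ks_loc_mul {g φ : KSE → ℝ} (hg : LocallyIntegrable g) (hφ : Continuous φ)
    (hc : HasCompactSupport φ) : Integrable (fun x => g x * φ x) := by
  have := hg.integrable_smul_right_of_hasCompactSupport hφ hc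
  simpa [mul_comm] using this

lemma ks_locint {M : ℝ} (hM : 0 < M) {f : ℕ → KSE → ℝ} {g : KSE → ℝ} {B : ℝ}
    (hpos : ∀ n x, 0 ≤ f n x) (hint : ∀ n, Integrable (f n)) (hmass : ∀ n, (∫ x, f n x) = M)
    (hm2int : ∀ n, Integrable (fun x => f n x * ‖x‖ ^ 2))
    (hm2 : ∀ n, (∫ x, f n x * ‖x‖ ^ 2) ≤ B)
    (hconv : ∀ φ : KSE → ℝ, ContDiff ℝ (⊤ : ℕ∞) φ → HasCompactSupport φ →
      Tendsto (fun n => ∫ x, f n x * φ x) atTop (nhds (∫ x, g x * φ x))) :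
    LocallyIntegrable g := by
  rw [locallyIntegrable_iff]
  intro K hK
  obtain ⟨R₀, hR₀⟩ := hK.isBounded.exists_norm_le
  set R := max R₀ (max 1 (2 * B / M)) with hRdef
  have hR1 : 1 ≤ R := (le_max_left _ _).trans (le_max_right _ _)
  have hR2 : 2 * B / M ≤ R := (le_max_right _ _).trans (le_max_right _ _)
  have hRp : 0 < R := by linarith
  have hcl : Integrable (fun x => g x * ksc R hRp x) := by
    by_contra hni
    have h1 := hconv (ksc R hRp) (ksc R hRp).contDiff (ksc R hRp).hasCompactSupport
    rw [integral_undef hni] at h1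
    have h2 : ∀ n, M / 2 ≤ ∫ x, f n x * ksc R hRp x := by
      intro n
      have h3 : ∫ x, (f n x - R⁻¹ * (f n x * ‖x‖ ^ 2)) ≤ ∫ x, f n x * ksc R hRp x := by
        apply integral_mono ((hint n).sub ((hm2int n).const_mul _))
        · apply ks_bdd_mul (hint n) (ksc R hRp).continuous
          refine ⟨1, fun x => ?_⟩
          rw [abs_of_nonneg (ksc R hRp).nonneg]
          exact (ksc R hRp).le_one
        · intro x
          simp only [Pi.sub_apply]
          have hf := hpos n x
          rcases le_or_gt ‖x‖ R with hx | hx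
          · rw [ksc_one hRp hx]
            have : 0 ≤ R⁻¹ * (f n x * ‖x‖ ^ 2) := by positivity
            linarith
          · have h4 : 0 ≤ f n x * ksc R hRp x := mul_nonneg hf (ksc R hRp).nonneg
            have h5 : 1 ≤ R⁻¹ * ‖x‖ ^ 2 := by
              rw [← div_eq_inv_mul, le_div_iff₀ hRp]
              nlinarith
            have h6 := mul_le_mul_of_nonneg_left h5 hf
            linarith
      rw [integral_sub (hint n) ((hm2int n).const_mul _), integral_const_mul, hmass n] at h3
      have h4 : R⁻¹ * ∫ x, f n x * ‖x‖ ^ 2 ≤ M / 2 := by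
        rw [← div_eq_inv_mul, div_le_iff₀ hRp]
        rw [div_le_iff₀ hM] at hR2
        linarith [hm2 n]
      linarith
    have := ge_of_tendsto' h1 h2
    linarith
  have h3 : IntegrableOn (fun x => g x * ksc R hRp x) K := hcl.integrableOn
  refine h3.congr_fun (fun x hx => ?_) hK.measurableSet
  simp only
  rw [ksc_one hRp ((hR₀ x hx).trans (le_max_left _ _)), mul_one]

/-- mollifiers -/
def ksm (n : ℕ) : ContDiffBump (0 : KSE) :=
  ⟨1 / ((n:ℝ) + 1), 2 * (1 / ((n:ℝ) + 1)), by positivity,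
    by have : 0 < 1 / ((n:ℝ) + 1) := by positivity
       linarith⟩

lemma ksm_tendsto {g : KSE → ℝ} (hg : LocallyIntegrable g) :
    ∀ᵐ x, Tendsto (fun n => ∫ t, (ksm n).normed volume (x - t) * g t) atTop (nhds (g x)) := by
  have h := ContDiffBump.ae_convolution_tendsto_right_of_locallyIntegrable (φ := ksm)
    (l := atTop) (K := 2) (g := g) (μ := volume) ?_ ?_ hg
  · filter_upwards [h] with x hx
    simpa [convolution_lsmul_swap] using hx
  · have := (tendsto_one_div_add_atTop_nhds_zero_nat (𝕜 := ℝ)).const_mul 2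
    simpa [ksm] using this
  · exact Eventually.of_forall fun n => le_of_eq rfl

lemma ks_nonneg {f : ℕ → KSE → ℝ} {g : KSE → ℝ} (hpos : ∀ n x, 0 ≤ f n x)
    (hg : LocallyIntegrable g)
    (hconv : ∀ φ : KSE → ℝ, ContDiff ℝ (⊤ : ℕ∞) φ → HasCompactSupport φ →
      Tendsto (fun n => ∫ x, f n x * φ x) atTop (nhds (∫ x, g x * φ x))) :
    ∀ᵐ x, 0 ≤ g x := by
  filter_upwards [ksm_tendsto hg] with x hx
  refine ge_of_tendsto' hx fun k => ?_
  have h1 := hconv (fun t => (ksm k).normed volume (x - t)) ?_ ?_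
  · have h2 : 0 ≤ ∫ t, g t * (ksm k).normed volume (x - t) :=
      ge_of_tendsto' h1 fun n => integral_nonneg fun t =>
        mul_nonneg (hpos n t) ((ksm k).nonneg_normed _)
    simpa [mul_comm] using h2
  · exact (ksm k).contDiff_normed.comp (contDiff_const.sub contDiff_id)
  · exact (ksm k).hasCompactSupport_normed.comp_homeomorph (Homeomorph.subLeft x)

lemma ks_moll {g : KSE → ℝ} {C : ℝ} (hg : Measurable g) (hC : ∀ x, |g x| ≤ C) :
    ∃ φ : ℕ → KSE → ℝ, (∀ n, Continuous (φ n)) ∧ (∀ n x, |φ n x| ≤ C) ∧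
      ∀ᵐ x, Tendsto (fun n => φ n x) atTop (nhds (g x)) := by
  have hl : LocallyIntegrable g := by
    have h1 : LocallyIntegrable (fun _ : KSE => C) := locallyIntegrable_const C
    refine h1.mono hg.aestronglyMeasurable (Eventually.of_forall fun x => ?_)
    exact (hC x).trans (le_abs_self C)
  refine ⟨fun n x => ∫ t, (ksm n).normed volume (x - t) * g t, fun n => ?_, fun n x => ?_,
    ksm_tendsto hl⟩
  · have := (ksm n).hasCompactSupport_normed (μ := volume) |>.continuous_convolution_left
      (ContinuousLinearMap.lsmul ℝ ℝ) (ksm n).continuous_normed hl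
    have e : (fun x => ∫ t, (ksm n).normed volume (x - t) * g t) =
        convolution ((ksm n).normed volume) g (ContinuousLinearMap.lsmul ℝ ℝ) volume := by
      funext x
      rw [convolution_lsmul_swap]
      rfl
    simp only [e]
    exact this
  · have hi : Integrable (fun t => (ksm n).normed volume (x - t)) :=
      ((ksm n).integrable_normed (μ := volume)).comp_sub_left x
    rw [← Real.norm_eq_abs]
    calc ‖∫ t, (ksm n).normed volume (x - t) * g t‖
        ≤ ∫ t, C * (ksm n).normed volume (x - t) := by
          apply norm_integral_le_of_norm_le (hi.const_mul C)
          apply Eventually.of_forall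
          intro t
          rw [norm_mul, Real.norm_of_nonneg ((ksm n).nonneg_normed _), mul_comm]
          exact mul_le_mul_of_nonneg_right (hC t) ((ksm n).nonneg_normed _)
      _ = C := by
          rw [integral_const_mul, integral_sub_left_eq_self, (ksm n).integral_normed, mul_one]

lemma ks_moments {M : ℝ} {f : ℕ → KSE → ℝ} {g : KSE → ℝ} {B : ℝ}
    (hpos : ∀ n x, 0 ≤ f n x) (hint : ∀ n, Integrable (f n)) (hmass : ∀ n, (∫ x, f n x) = M)
    (hm2int : ∀ n, Integrable (fun x => f n x * ‖x‖ ^ 2))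
    (hm2 : ∀ n, (∫ x, f n x * ‖x‖ ^ 2) ≤ B)
    (hconv : ∀ φ : KSE → ℝ, ContDiff ℝ (⊤ : ℕ∞) φ → HasCompactSupport φ →
      Tendsto (fun n => ∫ x, f n x * φ x) atTop (nhds (∫ x, g x * φ x)))
    (hg : LocallyIntegrable g) (hg0 : ∀ x, 0 ≤ g x) :
    Integrable g ∧ Integrable (fun x => g x * ‖x‖ ^ 2) := by
  have hk : ∀ k : ℕ, (0:ℝ) < (k:ℝ) + 1 := fun k => by positivity
  have hcont : ContDiff ℝ (⊤ : ℕ∞) (fun x : KSE => 1 + ‖x‖ ^ 2) :=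
    contDiff_const.add (contDiff_norm_sq ℝ)
  have hcd : ∀ k : ℕ, ContDiff ℝ (⊤ : ℕ∞) (fun x : KSE => ksc _ (hk k) x * (1 + ‖x‖ ^ 2)) :=
    fun k => (ksc _ (hk k)).contDiff.mul hcont
  have hcs : ∀ k : ℕ, HasCompactSupport (fun x : KSE => ksc _ (hk k) x * (1 + ‖x‖ ^ 2)) :=
    fun k => (ksc _ (hk k)).hasCompactSupport.mul_right
  have hmm : ∀ n, Integrable (fun x => f n x * (1 + ‖x‖ ^ 2)) := by
    intro n
    refine ((hint n).add (hm2int n)).congr (Eventually.of_forall fun x => ?_)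
    simp only [Pi.add_apply]; ring
  have hmmb : ∀ n, ∫ x, f n x * (1 + ‖x‖ ^ 2) ≤ M + B := by
    intro n
    have : ∫ x, f n x * (1 + ‖x‖ ^ 2) = M + ∫ x, f n x * ‖x‖ ^ 2 := by
      rw [← hmass n, ← integral_add (hint n) (hm2int n)]
      congr 1; funext x; ring
    linarith [hm2 n]
  have key := ks_fatou (G := fun k x => g x * (ksc _ (hk k) x * (1 + ‖x‖ ^ 2)))
    (G' := fun x => g x * (1 + ‖x‖ ^ 2)) (C := M + B) ?_ ?_ ?_ ?_
  · obtain ⟨hI, -⟩ := key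
    have hgm := hg.aestronglyMeasurable
    constructor
    · refine hI.mono hgm (Eventually.of_forall fun x => ?_)
      rw [norm_mul]
      apply le_mul_of_one_le_right (norm_nonneg _)
      rw [Real.norm_of_nonneg (by positivity)]
      nlinarith [sq_nonneg ‖x‖]
    · refine hI.mono (hgm.mul (by fun_prop)) (Eventually.of_forall fun x => ?_)
      rw [norm_mul, norm_mul]
      apply mul_le_mul_of_nonneg_left _ (norm_nonneg _)
      rw [Real.norm_of_nonneg (by positivity), Real.norm_of_nonneg (by positivity)]
      linarith
  · intro k x
    have := (ksc _ (hk k)).nonneg (x := x)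
    have := hg0 x
    positivity
  · intro k
    exact ks_loc_mul hg (hcd k).continuous (hcs k)
  · intro k
    refine le_of_tendsto' (hconv _ (hcd k) (hcs k)) fun n => ?_
    refine le_trans ?_ (hmmb n)
    apply integral_mono (ks_loc_mul (hint n).locallyIntegrable (hcd k).continuous (hcs k)) (hmm n)
    intro x
    simp only
    apply mul_le_mul_of_nonneg_left _ (hpos n x)
    apply mul_le_of_le_one_left (by positivity) (ksc _ (hk k)).le_one
  · apply Eventually.of_forall
    intro x
    apply tendsto_const_nhds.congr'
    obtain ⟨N, hN⟩ := exists_nat_gt ‖x‖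
    filter_upwards [eventually_ge_atTop N] with k hk'
    have : (N:ℝ) ≤ k := by exact_mod_cast hk'
    rw [ksc_one (hk k) (by linarith), one_mul]

/-- tail/smoothing error -/
lemma ks_approx {h φ ψ : KSE → ℝ} {δ C R M B : ℝ} (h0 : ∀ x, 0 ≤ h x) (hi : Integrable h)
    (h2 : Integrable (fun x => h x * ‖x‖ ^ 2)) (hM : ∫ x, h x ≤ M)
    (hB : ∫ x, h x * ‖x‖ ^ 2 ≤ B) (hδ : 0 ≤ δ) (hC : 0 ≤ C) (hR : 0 < R)
    (hφ : Integrable (fun x => h x * φ x)) (hψ : Integrable (fun x => h x * ψ x))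
    (hd : ∀ x, |ψ x - φ x| ≤ δ + C * ‖x‖ ^ 2 / R) :
    |(∫ x, h x * ψ x) - ∫ x, h x * φ x| ≤ δ * M + C * B / R := by
  rw [← integral_sub hψ hφ, ← Real.norm_eq_abs]
  have hb : Integrable (fun x => δ * h x + (C / R) * (h x * ‖x‖ ^ 2)) :=
    (hi.const_mul δ).add (h2.const_mul _)
  refine (norm_integral_le_of_norm_le hb (Eventually.of_forall fun x => ?_)).trans ?_
  · rw [← mul_sub, norm_mul, Real.norm_of_nonneg (h0 x), Real.norm_eq_abs]
    have := mul_le_mul_of_nonneg_left (hd x) (h0 x)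
    refine this.trans (le_of_eq ?_)
    ring
  · rw [integral_add (hi.const_mul δ) (h2.const_mul _), integral_const_mul, integral_const_mul]
    have a1 := mul_le_mul_of_nonneg_left hM hδ
    have a2 := mul_le_mul_of_nonneg_left hB (div_nonneg hC hR.le)
    have : C / R * B = C * B / R := by ring
    linarith

lemma ks_lin_int {h ψ : KSE → ℝ} {C : ℝ} (hi : Integrable h)
    (h2 : Integrable (fun x => h x * ‖x‖ ^ 2)) (hψ : Continuous ψ)
    (hC : ∀ x, |ψ x| ≤ C * (1 + ‖x‖)) : Integrable (fun x => h x * ψ x) := by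
  have hC0 : 0 ≤ C := by
    have := (abs_nonneg _).trans (hC 0)
    simpa using this
  refine ((hi.norm.add h2.norm).const_mul (2 * C)).mono'
    (hi.aestronglyMeasurable.mul hψ.aestronglyMeasurable) (Eventually.of_forall fun x => ?_)
  simp only [Pi.add_apply, norm_mul, norm_pow, norm_norm]
  have h1 : ‖ψ x‖ ≤ 2 * C * (1 + ‖x‖ ^ 2) := by
    have := hC x
    have h3 := ks_norm_le x
    rw [Real.norm_eq_abs]
    nlinarith [sq_nonneg ‖x‖]
  have := mul_le_mul_of_nonneg_left h1 (norm_nonneg (h x))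
  linarith

lemma ks_weak {f : ℕ → KSE → ℝ} {g : KSE → ℝ} {M B : ℝ}
    (hpos : ∀ n x, 0 ≤ f n x) (hint : ∀ n, Integrable (f n)) (hmass : ∀ n, (∫ x, f n x) ≤ M)
    (hm2int : ∀ n, Integrable (fun x => f n x * ‖x‖ ^ 2))
    (hm2 : ∀ n, (∫ x, f n x * ‖x‖ ^ 2) ≤ B)
    (hconv : ∀ φ : KSE → ℝ, ContDiff ℝ (⊤ : ℕ∞) φ → HasCompactSupport φ →
      Tendsto (fun n => ∫ x, f n x * φ x) atTop (nhds (∫ x, g x * φ x)))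
    (hg0 : ∀ x, 0 ≤ g x) (hgi : Integrable g) (hg2 : Integrable (fun x => g x * ‖x‖ ^ 2))
    {ψ : KSE → ℝ} (hψ : Continuous ψ) {C : ℝ} (hC : ∀ x, |ψ x| ≤ C * (1 + ‖x‖)) :
    Tendsto (fun n => ∫ x, f n x * ψ x) atTop (nhds (∫ x, g x * ψ x)) := by
  have hC0 : 0 ≤ C := by
    have := (abs_nonneg _).trans (hC 0)
    simpa using this
  set M' := max M (∫ x, g x) with hM'
  set B' := max B (∫ x, g x * ‖x‖ ^ 2) with hB'
  have hM0 : 0 ≤ M' := (integral_nonneg hg0).trans (le_max_right _ _)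
  have hB0 : 0 ≤ B' :=
    (integral_nonneg fun x => mul_nonneg (hg0 x) (by positivity)).trans (le_max_right _ _)
  rw [Metric.tendsto_atTop]
  intro η hη
  set δ := min 1 (η / 8 / (M' + 1)) with hδdef
  have hδ : 0 < δ := by positivity
  have hδ1 : δ ≤ 1 := min_le_left _ _
  have hδM : δ * M' ≤ η / 8 := by
    have h1 : δ ≤ η / 8 / (M' + 1) := min_le_right _ _
    rw [le_div_iff₀ (by positivity)] at h1
    nlinarith
  set R := max 1 ((2 * C + 1) * B' * 8 / η) with hRdef
  have hR1 : 1 ≤ R := le_max_left _ _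
  have hRp : 0 < R := by linarith
  have hRB : (2 * C + 1) * B' / R ≤ η / 8 := by
    have h1 : (2 * C + 1) * B' * 8 / η ≤ R := le_max_right _ _
    rw [div_le_iff₀ hη] at h1
    rw [div_le_iff₀ hRp]
    linarith
  obtain ⟨θ, hθ, hθd, -⟩ := hψ.exists_contDiff_approx (⊤ : ℕ∞) (ε := fun _ => δ)
    continuous_const (fun _ => hδ)
  have hφd : ContDiff ℝ (⊤ : ℕ∞) (fun x => ksc R hRp x * θ x) := (ksc R hRp).contDiff.mul hθ
  have hφc : HasCompactSupport (fun x => ksc R hRp x * θ x) :=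
    (ksc R hRp).hasCompactSupport.mul_right
  have hd : ∀ x, |ψ x - ksc R hRp x * θ x| ≤ δ + (2 * C + 1) * ‖x‖ ^ 2 / R := by
    intro x
    have h1 : |ψ x - θ x| ≤ δ := by
      have := (hθd x).le
      rwa [dist_comm, Real.dist_eq] at this
    have hc0 := (ksc R hRp).nonneg (x := x)
    have hc1 := (ksc R hRp).le_one (x := x)
    rcases le_or_gt ‖x‖ R with hx | hx
    · rw [ksc_one hRp hx, one_mul]
      have : 0 ≤ (2 * C + 1) * ‖x‖ ^ 2 / R := by positivity
      linarith
    · have e : ψ x - ksc R hRp x * θ x = (ψ x - θ x) * ksc R hRp x + (1 - ksc R hRp x) * ψ x := by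
        ring
      have h2 : |(ψ x - θ x) * ksc R hRp x| ≤ δ := by
        rw [abs_mul, abs_of_nonneg hc0]
        nlinarith [abs_nonneg (ψ x - θ x)]
      have h3 : |(1 - ksc R hRp x) * ψ x| ≤ C * (1 + ‖x‖) := by
        rw [abs_mul, abs_of_nonneg (by linarith : 0 ≤ 1 - ksc R hRp x)]
        have := hC x
        nlinarith [abs_nonneg (ψ x)]
      have h4 : C * (1 + ‖x‖) ≤ (2 * C + 1) * ‖x‖ ^ 2 / R := by
        rw [le_div_iff₀ hRp]
        have h5 : (1 + ‖x‖) * R ≤ 2 * ‖x‖ ^ 2 := by nlinarith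
        have h6 := mul_le_mul_of_nonneg_left h5 hC0
        nlinarith [sq_nonneg ‖x‖]
      rw [e]
      refine (abs_add_le _ _).trans ?_
      linarith
  have hcv := hconv _ hφd hφc
  rw [Metric.tendsto_atTop] at hcv
  obtain ⟨N, hN⟩ := hcv (η / 8) (by linarith)
  refine ⟨N, fun n hn => ?_⟩
  have h1 := hN n hn
  have hK : 0 ≤ 2 * C + 1 := by linarith
  have h2 := ks_approx (hpos n) (hint n) (hm2int n) ((hmass n).trans (le_max_left _ _ : M ≤ M'))
    ((hm2 n).trans (le_max_left _ _ : B ≤ B')) hδ.le hK hRp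
    (ks_loc_mul (hint n).locallyIntegrable hφd.continuous hφc)
    (ks_lin_int (hint n) (hm2int n) hψ hC) hd
  have h3 := ks_approx hg0 hgi hg2 (le_max_right _ _ : _ ≤ M')
    (le_max_right _ _ : _ ≤ B') hδ.le hK hRp
    (ks_loc_mul hgi.locallyIntegrable hφd.continuous hφc)
    (ks_lin_int hgi hg2 hψ hC) hd
  rw [Real.dist_eq] at h1 ⊢
  rw [abs_lt] at h1 ⊢
  rw [abs_le] at h2 h3
  constructor <;> linarith

lemma ks_lw' {g : KSE → ℝ} (hgi : Integrable g) (hg2 : Integrable (fun x => g x * ‖x‖ ^ 2)) :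
    Integrable (fun x => g x * Real.log (ksw x)) := by
  apply ks_lin_int hgi hg2 ksw_log_cont (C := 3)
  intro x
  rw [abs_of_nonpos (ksw_log_nonpos x)]
  linarith [ksw_log_ge x]

lemma ks_dual_cont {f : ℕ → KSE → ℝ} {g : KSE → ℝ} {M c : ℝ} (hf : ∀ n, KSGood (f n))
    (hmass : ∀ n, (∫ x, f n x) = M)
    (hgi : Integrable g) (hg2 : Integrable (fun x => g x * ‖x‖ ^ 2))
    (hw : ∀ ψ : KSE → ℝ, Continuous ψ → ∀ C : ℝ, (∀ x, |ψ x| ≤ C * (1 + ‖x‖)) →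
      Tendsto (fun n => ∫ x, f n x * ψ x) atTop (nhds (∫ x, g x * ψ x)))
    (hc : ∃ᶠ n in atTop, (∫ x, f n x * Real.log (f n x)) ≤ c)
    {φ : KSE → ℝ} {C : ℝ} (hφ : Continuous φ) (hC : ∀ x, |φ x| ≤ C) :
    (∫ x, g x * φ x) + (∫ x, g x * Real.log (ksw x)) ≤ c - M + ∫ x, ksw x * Real.exp (φ x) := by
  have hC0 : 0 ≤ C := (abs_nonneg _).trans (hC 0)
  have hbd : ∀ x, |φ x + Real.log (ksw x)| ≤ (C + 3) * (1 + ‖x‖) := by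
    intro x
    have h1 := hC x
    have h2 := ksw_log_nonpos x
    have h3 := ksw_log_ge x
    have h4 := norm_nonneg x
    have h5 : 0 ≤ C * ‖x‖ := by positivity
    rw [abs_le] at h1 ⊢
    constructor <;> linarith
  have hcont : Continuous (fun x => φ x + Real.log (ksw x)) := hφ.add ksw_log_cont
  have hlim := hw _ hcont _ hbd
  have hie : Integrable (fun x => ksw x * Real.exp (φ x)) := by
    apply ks_bdd_mul ksw_int (by fun_prop)
    refine ⟨Real.exp C, fun x => ?_⟩
    rw [abs_of_nonneg (Real.exp_pos _).le]
    exact Real.exp_le_exp.mpr ((le_abs_self _).trans (hC x))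
  have hgφ : Integrable (fun x => g x * φ x) := ks_bdd_mul hgi hφ ⟨C, hC⟩
  have e : ∫ x, g x * (φ x + Real.log (ksw x)) =
      (∫ x, g x * φ x) + ∫ x, g x * Real.log (ksw x) := by
    rw [← integral_add hgφ (ks_lw' hgi hg2)]
    congr 1; funext x; ring
  rw [← e]
  refine le_of_tendsto_of_frequently hlim (hc.mono fun n hn => ?_)
  have h := hf n
  have h1 : ∫ x, f n x * (φ x + Real.log (ksw x)) ≤
      ∫ x, ((f n x * Real.log (f n x) - f n x) + ksw x * Real.exp (φ x)) := by
    apply integral_mono (ks_lin_int h.int h.m2 hcont hbd) ((h.ent.sub h.int).add hie)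
    intro x
    simp only [Pi.add_apply, Pi.sub_apply]
    have := ks_young (f n x) (φ x + Real.log (ksw x)) (h.nonneg x)
    rw [Real.exp_add, Real.exp_log (ksw_pos x)] at this
    linarith
  have e2 : ∫ x, ((f n x * Real.log (f n x) - f n x) + ksw x * Real.exp (φ x)) =
      (∫ x, f n x * Real.log (f n x)) - (∫ x, f n x) + ∫ x, ksw x * Real.exp (φ x) := by
    rw [← integral_sub h.ent h.int, ← integral_add _ hie]
    exact h.ent.sub h.int
  rw [e2, hmass n] at h1
  linarith

lemma ks_dual_meas {g : KSE → ℝ} {M c : ℝ} (hgi : Integrable g)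
    (hd : ∀ (φ : KSE → ℝ) (C : ℝ), Continuous φ → (∀ x, |φ x| ≤ C) →
      (∫ x, g x * φ x) + (∫ x, g x * Real.log (ksw x)) ≤ c - M + ∫ x, ksw x * Real.exp (φ x))
    {φ : KSE → ℝ} {C : ℝ} (hφ : Measurable φ) (hC : ∀ x, |φ x| ≤ C) :
    (∫ x, g x * φ x) + (∫ x, g x * Real.log (ksw x)) ≤ c - M + ∫ x, ksw x * Real.exp (φ x) := by
  obtain ⟨θ, h1, h2, h3⟩ := ks_moll hφ hC
  have t1 : Tendsto (fun n => ∫ x, g x * θ n x) atTop (nhds (∫ x, g x * φ x)) := by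
    apply tendsto_integral_of_dominated_convergence (fun x => ‖g x‖ * C)
    · exact fun n => hgi.aestronglyMeasurable.mul (h1 n).aestronglyMeasurable
    · exact hgi.norm.mul_const C
    · intro n
      apply Eventually.of_forall
      intro x
      rw [norm_mul]
      exact mul_le_mul_of_nonneg_left (h2 n x) (norm_nonneg _)
    · filter_upwards [h3] with x hx
      exact hx.const_mul _
  have t2 : Tendsto (fun n => ∫ x, ksw x * Real.exp (θ n x)) atTop
      (nhds (∫ x, ksw x * Real.exp (φ x))) := by
    apply tendsto_integral_of_dominated_convergence (fun x => ksw x * Real.exp C)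
    · exact fun n => ksw_cont.aestronglyMeasurable.mul
        (Real.continuous_exp.comp (h1 n)).aestronglyMeasurable
    · exact ksw_int.mul_const _
    · intro n
      apply Eventually.of_forall
      intro x
      rw [norm_mul, Real.norm_of_nonneg (ksw_pos x).le, Real.norm_of_nonneg (Real.exp_pos _).le]
      apply mul_le_mul_of_nonneg_left _ (ksw_pos x).le
      exact Real.exp_le_exp.mpr ((le_abs_self _).trans (h2 n x))
    · filter_upwards [h3] with x hx
      exact ((Real.continuous_exp.tendsto _).comp hx).const_mul _
  exact le_of_tendsto_of_tendsto' (t1.add_const _) (t2.const_add _)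
    (fun n => hd (θ n) C (h1 n) (h2 n))

lemma ks_ent_dual {g : KSE → ℝ} {M c : ℝ} (hg0 : ∀ x, 0 ≤ g x) (hgm : Measurable g)
    (hgi : Integrable g) (hg2 : Integrable (fun x => g x * ‖x‖ ^ 2)) (hM : ∫ x, g x = M)
    (hd : ∀ (φ : KSE → ℝ) (C : ℝ), Measurable φ → (∀ x, |φ x| ≤ C) →
      (∫ x, g x * φ x) + (∫ x, g x * Real.log (ksw x)) ≤ c - M + ∫ x, ksw x * Real.exp (φ x)) :
    Integrable (fun x => g x * Real.log (g x)) ∧ ∫ x, g x * Real.log (g x) ≤ c := by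
  set u : ℕ → KSE → ℝ := fun k x => max (1 / ((k:ℝ) + 1)) (min ((k:ℝ) + 1) (g x / ksw x)) with hu
  have hkp : ∀ k : ℕ, (0:ℝ) < (k:ℝ) + 1 := fun k => by positivity
  have hk1 : ∀ k : ℕ, (1:ℝ) ≤ (k:ℝ) + 1 := fun k => by
    have : (0:ℝ) ≤ k := Nat.cast_nonneg k
    linarith
  have hki : ∀ k : ℕ, 1 / ((k:ℝ) + 1) ≤ 1 := fun k => by
    rw [div_le_one (hkp k)]; exact hk1 k
  have hulo : ∀ (k : ℕ) (x : KSE), 1 / ((k:ℝ) + 1) ≤ u k x := fun k x => le_max_left _ _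
  have huhi : ∀ (k : ℕ) (x : KSE), u k x ≤ (k:ℝ) + 1 := fun k x =>
    max_le ((hki k).trans (hk1 k)) (min_le_left _ _)
  have hup : ∀ k x, 0 < u k x := fun k x => lt_of_lt_of_le (by have := hkp k; positivity) (hulo k x)
  have hum : ∀ k, Measurable (u k) := fun k =>
    measurable_const.max (measurable_const.min (hgm.div ksw_cont.measurable))
  have hlm : ∀ k, Measurable (fun x => Real.log (u k x)) := fun k => (hum k).log
  have hlb : ∀ (k : ℕ) (x : KSE), |Real.log (u k x)| ≤ Real.log ((k:ℝ) + 1) := by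
    intro k x
    rw [abs_le]
    constructor
    · have := Real.log_le_log (by have := hkp k; positivity) (hulo k x)
      rwa [one_div, Real.log_inv] at this
    · exact Real.log_le_log (hup k x) (huhi k x)
  have hgl : ∀ k, Integrable (fun x => g x * Real.log (u k x)) := fun k =>
    hgi.mul_bdd (c := Real.log ((k:ℝ) + 1)) (hlm k).aestronglyMeasurable
      (Eventually.of_forall (hlb k))
  have hwu : ∀ k, Integrable (fun x => ksw x * u k x) := fun k =>
    ksw_int.mul_bdd (c := (k:ℝ) + 1) (hum k).aestronglyMeasurable
      (Eventually.of_forall fun x => by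
        rw [Real.norm_of_nonneg (hup k x).le]; exact huhi k x)
  have hlw := ks_lw' hgi hg2
  obtain ⟨hI, hIle⟩ := ks_fatou (G := fun k x => g x * Real.log (u k x) - ksw x * u k x + ksw x)
    (G' := fun x => g x * Real.log (g x / ksw x) - ksw x * (g x / ksw x) + ksw x)
    (C := c - M - (∫ x, g x * Real.log (ksw x)) + ∫ x, ksw x) (by
      intro k x
      have hw := ksw_pos x
      set v := g x / ksw x with hv
      have hgv : g x = ksw x * v := by rw [hv]; field_simp
      have hU := hup k x
      have key : 0 ≤ v * Real.log (u k x) - u k x + 1 := by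
        have h1 : u k x - 1 ≤ u k x * Real.log (u k x) := by
          have := ks_young (u k x) 0 hU.le
          rw [Real.exp_zero, mul_zero] at this
          linarith
        have h2 : u k x * Real.log (u k x) ≤ v * Real.log (u k x) := by
          rcases le_or_gt v (1 / ((k:ℝ) + 1)) with hA | hA
          · have e : u k x = 1 / ((k:ℝ) + 1) := max_eq_left ((min_le_right _ _).trans hA)
            have : Real.log (u k x) ≤ 0 := Real.log_nonpos hU.le (e ▸ hki k)
            apply mul_le_mul_of_nonpos_right _ this
            rw [e]; exact hA
          · rcases le_or_gt v ((k:ℝ) + 1) with hB | hB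
            · have e : u k x = v := by
                change max _ (min _ v) = v
                rw [min_eq_right hB, max_eq_right hA.le]
              rw [e]
            · have e : u k x = (k:ℝ) + 1 := by
                change max _ (min _ v) = _
                rw [min_eq_left hB.le, max_eq_right ((hki k).trans (hk1 k))]
              apply mul_le_mul_of_nonneg_right
              · rw [e]; exact hB.le
              · exact Real.log_nonneg (by rw [e]; exact hk1 k)
        linarith
      have := mul_nonneg hw.le key
      rw [hgv]
      nlinarith)
    (fun k => ((hgl k).sub (hwu k)).add ksw_int) (by
      intro k
      have e : ∫ x, (g x * Real.log (u k x) - ksw x * u k x + ksw x) =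
          (∫ x, g x * Real.log (u k x)) - (∫ x, ksw x * u k x) + ∫ x, ksw x := by
        rw [← integral_sub (hgl k) (hwu k), ← integral_add _ ksw_int]
        exact (hgl k).sub (hwu k)
      have h1 := hd _ _ (hlm k) (hlb k)
      have e2 : (fun x => ksw x * Real.exp (Real.log (u k x))) = fun x => ksw x * u k x := by
        funext x; rw [Real.exp_log (hup k x)]
      rw [e2] at h1
      rw [e]
      linarith) (by
      apply Eventually.of_forall
      intro x
      have hw := ksw_pos x
      have ht : Tendsto (fun k => u k x) atTop (nhds (g x / ksw x)) := by
        have h0 : 0 ≤ g x / ksw x := div_nonneg (hg0 x) hw.le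
        have h1 := (tendsto_one_div_add_atTop_nhds_zero_nat (𝕜 := ℝ)).max
          (tendsto_const_nhds (x := g x / ksw x))
        rw [max_eq_right h0] at h1
        apply h1.congr'
        obtain ⟨N, hN⟩ := exists_nat_gt (g x / ksw x)
        filter_upwards [eventually_ge_atTop N] with k hk
        have : (N:ℝ) ≤ k := by exact_mod_cast hk
        simp only [hu]
        rw [min_eq_right (by linarith)]
      refine Tendsto.add_const _ (Tendsto.sub ?_ (ht.const_mul _))
      rcases (hg0 x).eq_or_lt with h | h
      · rw [← h]; simp
      · exact (ht.log (div_pos h hw).ne').const_mul _)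
  have hlog : ∀ x, g x * Real.log (g x) =
      (g x * Real.log (g x / ksw x) - ksw x * (g x / ksw x) + ksw x) + g x
        + g x * Real.log (ksw x) - ksw x := by
    intro x
    have hw := ksw_pos x
    have e1 : ksw x * (g x / ksw x) = g x := by field_simp
    rcases (hg0 x).eq_or_lt with h | h
    · rw [← h]; simp
    · rw [Real.log_div h.ne' hw.ne', e1]; ring
  have hI2 := ((hI.add hgi).add hlw).sub ksw_int
  constructor
  · refine hI2.congr (Eventually.of_forall fun x => ?_)
    simp only [Pi.add_apply, Pi.sub_apply]
    exact (hlog x).symm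
  · have : ∫ x, g x * Real.log (g x) =
        (∫ x, (g x * Real.log (g x / ksw x) - ksw x * (g x / ksw x) + ksw x)) + (∫ x, g x)
        + (∫ x, g x * Real.log (ksw x)) - ∫ x, ksw x := by
      rw [← integral_add hI hgi, ← integral_add _ hlw, ← integral_sub _ ksw_int]
      · congr 1; funext x; exact hlog x
      · exact (hI.add hgi).add hlw
      · exact hI.add hgi
    rw [this, hM]
    linarith

lemma ks_ent_lsc {f : ℕ → KSE → ℝ} {g : KSE → ℝ} {M c : ℝ} (hf : ∀ n, KSGood (f n))
    (hmass : ∀ n, (∫ x, f n x) = M) (hg0 : ∀ x, 0 ≤ g x) (hgm : Measurable g)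
    (hgi : Integrable g) (hg2 : Integrable (fun x => g x * ‖x‖ ^ 2)) (hM : ∫ x, g x = M)
    (hw : ∀ ψ : KSE → ℝ, Continuous ψ → ∀ C : ℝ, (∀ x, |ψ x| ≤ C * (1 + ‖x‖)) →
      Tendsto (fun n => ∫ x, f n x * ψ x) atTop (nhds (∫ x, g x * ψ x)))
    (hc : ∃ᶠ n in atTop, (∫ x, f n x * Real.log (f n x)) ≤ c) :
    Integrable (fun x => g x * Real.log (g x)) ∧ ∫ x, g x * Real.log (g x) ≤ c :=
  ks_ent_dual hg0 hgm hgi hg2 hM fun _ _ hφ hC =>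
    ks_dual_meas hgi (fun _ _ hθ hCθ => ks_dual_cont hf hmass hgi hg2 hw hc hθ hCθ) hφ hC

lemma ks_wd_prob {h : KSE → ℝ} (h0 : ∀ x, 0 ≤ h x) (hi : Integrable h) (h1 : ∫ x, h x = 1) :
    IsProbabilityMeasure ((volume : Measure KSE).withDensity (fun x => ENNReal.ofReal (h x))) := by
  constructor
  rw [withDensity_apply _ MeasurableSet.univ, Measure.restrict_univ,
    ← ofReal_integral_eq_lintegral_ofReal hi (Eventually.of_forall h0), h1, ENNReal.ofReal_one]

lemma ks_wd_int {h : KSE → ℝ} (h0 : ∀ x, 0 ≤ h x) (hi : Integrable h) (φ : KSE → ℝ) :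
    ∫ x, φ x ∂((volume : Measure KSE).withDensity (fun x => ENNReal.ofReal (h x))) =
      ∫ x, h x * φ x := by
  rw [integral_withDensity_eq_integral_toReal_smul₀ hi.aemeasurable.ennreal_ofReal
    (Eventually.of_forall fun x => ENNReal.ofReal_lt_top)]
  congr 1; funext x
  rw [ENNReal.toReal_ofReal (h0 x), smul_eq_mul]

lemma ks_wd_prod {h : KSE → ℝ} (h0 : ∀ x, 0 ≤ h x) (hi : Integrable h) (φ : KSE × KSE → ℝ) :
    ∫ q, φ q ∂(((volume : Measure KSE).withDensity (fun x => ENNReal.ofReal (h x))).prod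
      ((volume : Measure KSE).withDensity (fun x => ENNReal.ofReal (h x)))) =
      ∫ q : KSE × KSE, h q.1 * h q.2 * φ q := by
  have hm := hi.aemeasurable.ennreal_ofReal
  rw [prod_withDensity₀ hm hm, integral_withDensity_eq_integral_toReal_smul₀]
  · rw [Measure.volume_eq_prod]
    congr 1; funext q
    rw [ENNReal.toReal_mul, ENNReal.toReal_ofReal (h0 _), ENNReal.toReal_ofReal (h0 _), smul_eq_mul]
  · exact (hm.comp_fst).mul (hm.comp_snd)
  · exact Eventually.of_forall fun x => ENNReal.mul_lt_top ENNReal.ofReal_lt_top ENNReal.ofReal_lt_top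

lemma ks_prod_weak1 {f : ℕ → KSE → ℝ} {g : KSE → ℝ}
    (hf0 : ∀ n x, 0 ≤ f n x) (hfi : ∀ n, Integrable (f n)) (hf1 : ∀ n, ∫ x, f n x = 1)
    (hg0 : ∀ x, 0 ≤ g x) (hgi : Integrable g) (hg1 : ∫ x, g x = 1)
    (hw : ∀ ψ : KSE → ℝ, Continuous ψ → ∀ C : ℝ, (∀ x, |ψ x| ≤ C) →
      Tendsto (fun n => ∫ x, f n x * ψ x) atTop (nhds (∫ x, g x * ψ x)))
    {Ψ : KSE × KSE → ℝ} (hΨ : Continuous Ψ) {C : ℝ} (hC : ∀ q, |Ψ q| ≤ C) :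
    Tendsto (fun n => ∫ q : KSE × KSE, f n q.1 * f n q.2 * Ψ q) atTop
      (nhds (∫ q : KSE × KSE, g q.1 * g q.2 * Ψ q)) := by
  let μ : ℕ → ProbabilityMeasure KSE := fun n => ⟨_, ks_wd_prob (hf0 n) (hfi n) (hf1 n)⟩
  let ν : ProbabilityMeasure KSE := ⟨_, ks_wd_prob hg0 hgi hg1⟩
  have h1 : Tendsto μ atTop (nhds ν) := by
    rw [ProbabilityMeasure.tendsto_iff_forall_integral_tendsto]
    intro φ
    have h2 := hw φ φ.continuous ‖φ‖ (fun x => φ.norm_coe_le_norm x)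
    have e1 : ∀ n, ∫ x, φ x ∂(μ n : Measure KSE) = ∫ x, f n x * φ x :=
      fun n => ks_wd_int (hf0 n) (hfi n) φ
    have e2 : ∫ x, φ x ∂(ν : Measure KSE) = ∫ x, g x * φ x := ks_wd_int hg0 hgi φ
    simp only [e1, e2]
    exact h2
  have h2 : Tendsto (fun n => (μ n).prod (μ n)) atTop (nhds (ν.prod ν)) :=
    (ProbabilityMeasure.continuous_prod.tendsto (ν, ν)).comp (h1.prodMk_nhds h1)
  rw [ProbabilityMeasure.tendsto_iff_forall_integral_tendsto] at h2
  have h3 := h2 (BoundedContinuousFunction.ofNormedAddCommGroup Ψ hΨ C hC)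
  have e1 : ∀ n, ∫ q, Ψ q ∂((μ n).prod (μ n) : Measure (KSE × KSE)) =
      ∫ q : KSE × KSE, f n q.1 * f n q.2 * Ψ q := fun n => ks_wd_prod (hf0 n) (hfi n) Ψ
  have e2 : ∫ q, Ψ q ∂(ν.prod ν : Measure (KSE × KSE)) =
      ∫ q : KSE × KSE, g q.1 * g q.2 * Ψ q := ks_wd_prod hg0 hgi Ψ
  simp only [BoundedContinuousFunction.coe_ofNormedAddCommGroup, e1, e2] at h3
  exact h3

lemma ks_prod_weak {f : ℕ → KSE → ℝ} {g : KSE → ℝ} {M : ℝ} (hM : 0 < M)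
    (hf0 : ∀ n x, 0 ≤ f n x) (hfi : ∀ n, Integrable (f n)) (hf1 : ∀ n, ∫ x, f n x = M)
    (hg0 : ∀ x, 0 ≤ g x) (hgi : Integrable g) (hg1 : ∫ x, g x = M)
    (hw : ∀ ψ : KSE → ℝ, Continuous ψ → ∀ C : ℝ, (∀ x, |ψ x| ≤ C) →
      Tendsto (fun n => ∫ x, f n x * ψ x) atTop (nhds (∫ x, g x * ψ x)))
    {Ψ : KSE × KSE → ℝ} (hΨ : Continuous Ψ) {C : ℝ} (hC : ∀ q, |Ψ q| ≤ C) :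
    Tendsto (fun n => ∫ q : KSE × KSE, f n q.1 * f n q.2 * Ψ q) atTop
      (nhds (∫ q : KSE × KSE, g q.1 * g q.2 * Ψ q)) := by
  have hMi : 0 ≤ M⁻¹ := (inv_pos.mpr hM).le
  have h := ks_prod_weak1 (f := fun n x => M⁻¹ * f n x) (g := fun x => M⁻¹ * g x)
    (fun n x => mul_nonneg hMi (hf0 n x)) (fun n => (hfi n).const_mul _)
    (fun n => by rw [integral_const_mul, hf1 n, inv_mul_cancel₀ hM.ne'])
    (fun x => mul_nonneg hMi (hg0 x)) (hgi.const_mul _)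
    (by rw [integral_const_mul, hg1, inv_mul_cancel₀ hM.ne'])
    (fun ψ hψ C hC => by
      have := (hw ψ hψ C hC).const_mul M⁻¹
      simpa only [mul_assoc, integral_const_mul] using this) hΨ hC
  have key : ∀ k : KSE → ℝ, M ^ 2 * (∫ q : KSE × KSE, (M⁻¹ * k q.1) * (M⁻¹ * k q.2) * Ψ q) =
      ∫ q : KSE × KSE, k q.1 * k q.2 * Ψ q := by
    intro k
    rw [← integral_const_mul]
    congr 1; funext q
    field_simp
  have h2 := h.const_mul (M ^ 2)
  simp only [key] at h2
  exact h2

lemma ks_unif {M A B : ℝ} (hM : M ∈ Set.Ioo 0 (8 * π)) :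
    ∃ C L : ℝ, ∀ f : KSE → ℝ, KSGood f → ∫ x, f x = M → ∫ x, f x * ‖x‖ ^ 2 ≤ B →
      freeEnergy f ≤ A → (∫ x, f x * Real.log (f x)) ≤ C ∧ L ≤ freeEnergy f := by
  obtain ⟨hM0, hM8⟩ := hM
  have hπ := Real.pi_pos
  set l := (M / (4 * π) + 2) / 2 with hl
  have hm : M / (4 * π) < 2 := by rw [div_lt_iff₀ (by positivity)]; linarith
  have hm0 : 0 < M / (4 * π) := by positivity
  have hl0 : 0 < l := by rw [hl]; linarith
  have hl2 : l < 2 := by rw [hl]; linarith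
  have hml : M / (4 * π) < l := by rw [hl]; linarith
  set θ := M / (4 * π) / l with hθ
  have hθ0 : 0 < θ := by positivity
  have hθ1 : θ < 1 := by rw [hθ, div_lt_one hl0]; exact hml
  set Q := 3 * (M + B) + (∫ x, ksw x) + ∫ z, ksj l 1 z with hQ
  refine ⟨(A + θ * Q) / (1 - θ), (1 - θ) * (-(3 * (M + B)) - ∫ x, ksw x) - θ * Q, ?_⟩
  intro f hf h1 h2 h3
  have hh := hf.hls hl0 hl2
  have hge := hf.ent_ge
  rw [h1] at hh hge
  unfold freeEnergy at h3 ⊢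
  set H := ∫ x, f x * Real.log (f x) with hH
  have hkey : -(θ * (H + Q)) ≤ (1 / (4 * π)) *
      ∫ q : KSE × KSE, f q.1 * f q.2 * Real.log ‖q.1 - q.2‖ := by
    set D := ∫ q : KSE × KSE, f q.1 * f q.2 * Real.log ‖q.1 - q.2‖ with hD
    have h4 : -l * D ≤ M * (H + Q) := by
      refine hh.trans (mul_le_mul_of_nonneg_left ?_ hM0.le)
      rw [hQ]; linarith
    have h5 := mul_le_mul_of_nonneg_left h4 (by positivity : 0 ≤ 1 / (4 * π) / l)
    have e1 : 1 / (4 * π) / l * (-l * D) = -(1 / (4 * π) * D) := by field_simp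
    have e2 : 1 / (4 * π) / l * (M * (H + Q)) = θ * (H + Q) := by rw [hθ]; field_simp
    rw [e1, e2] at h5
    linarith
  constructor
  · rw [le_div_iff₀ (by linarith)]
    linarith
  · have h6 : -(3 * (M + B)) - (∫ x, ksw x) ≤ H := by linarith
    have h7 := mul_le_mul_of_nonneg_left h6 (by linarith : 0 ≤ 1 - θ)
    linarith

lemma ks_short_unif {M C₁ δ : ℝ} (hM : 0 < M) (hC : 0 ≤ C₁) (hδ : 0 < δ) :
    ∃ e : ℝ, 0 < e ∧ ∀ f : KSE → ℝ, KSGood f → ∫ x, f x = M →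
      (∫ x, |f x * Real.log (f x)|) ≤ C₁ → ∀ N : ℝ,
      (∫ q : KSE × KSE, f q.1 * f q.2 * min (ksL e (q.1 - q.2)) N) -
      (∫ q : KSE × KSE, f q.1 * f q.2 * Real.log ‖q.1 - q.2‖) ≤ δ := by
  set s := max 1 (2 * (C₁ ^ 2 + C₁) / δ) with hs
  have hs1 : 1 ≤ s := le_max_left _ _
  have hs2 : 2 * (C₁ ^ 2 + C₁) / δ ≤ s := le_max_right _ _
  rw [div_le_iff₀ hδ] at hs2
  set K := Real.exp s with hK
  have hKp : 0 < K := Real.exp_pos s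
  have hK1 : 1 < K := Real.one_lt_exp_iff.mpr (by linarith)
  have hev := (ksj_tendsto 1 (by norm_num)).eventually
    (gt_mem_nhds (show (0:ℝ) < min 1 (δ / (4 * K * M)) by positivity))
  obtain ⟨n, hn⟩ := hev.exists
  have hnn : (0:ℝ) ≤ n := Nat.cast_nonneg n
  have hep : 0 < 1 / ((n:ℝ) + 2) := by positivity
  have he1 : 1 / ((n:ℝ) + 2) ≤ 1 := by
    rw [div_le_one (by positivity)]; linarith
  refine ⟨1 / ((n:ℝ) + 2), hep, fun f hf h1 h2 N => ?_⟩
  refine (hf.short hep he1 hK1).trans ?_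
  rw [h1, hK, Real.log_exp, ← hK]
  set J := ∫ z, ksj 1 (1 / ((n:ℝ) + 2)) z with hJ
  have hJ0 : 0 ≤ J := integral_nonneg (ksj_nonneg _ _)
  have hJ1 : J ≤ 1 := hn.le.trans (min_le_left _ _)
  have hJ2 : J ≤ δ / (4 * K * M) := hn.le.trans (min_le_right _ _)
  rw [le_div_iff₀ (by positivity)] at hJ2
  set a := ∫ x, |f x * Real.log (f x)| with ha
  have ha0 : 0 ≤ a := integral_nonneg fun x => abs_nonneg _
  have h3 : a ^ 2 + a * J ≤ C₁ ^ 2 + C₁ := by nlinarith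
  have h4 : (1 / s) * (a ^ 2 + a * J) ≤ δ / 2 := by
    rw [one_div, ← div_eq_inv_mul, div_le_iff₀ (by linarith)]
    linarith
  have h5 : 2 * K * (M * J) ≤ δ / 2 := by linarith
  linarith

lemma ks_main {M A B : ℝ} (hM : M ∈ Set.Ioo 0 (8 * π)) {f : ℕ → KSE → ℝ} {g : KSE → ℝ}
    (hf : ∀ n, KSGood (f n)) (hmass : ∀ n, (∫ x, f n x) = M)
    (hm2 : ∀ n, (∫ x, f n x * ‖x‖ ^ 2) ≤ B) (hF : ∀ n, freeEnergy (f n) ≤ A)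
    (hg0 : ∀ x, 0 ≤ g x) (hgm : Measurable g)
    (hgi : Integrable g) (hg2 : Integrable (fun x => g x * ‖x‖ ^ 2)) (hgM : ∫ x, g x = M)
    (hw : ∀ ψ : KSE → ℝ, Continuous ψ → ∀ C : ℝ, (∀ x, |ψ x| ≤ C * (1 + ‖x‖)) →
      Tendsto (fun n => ∫ x, f n x * ψ x) atTop (nhds (∫ x, g x * ψ x))) :
    freeEnergy g ≤ liminf (fun n => freeEnergy (f n)) atTop := by
  have hπ := Real.pi_pos
  obtain ⟨C, L, hCL⟩ := ks_unif (A := A) (B := B) hM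
  have hH : ∀ n, (∫ x, f n x * Real.log (f n x)) ≤ C := fun n =>
    (hCL (f n) (hf n) (hmass n) (hm2 n) (hF n)).1
  have hL : ∀ n, L ≤ freeEnergy (f n) := fun n =>
    (hCL (f n) (hf n) (hmass n) (hm2 n) (hF n)).2
  have hgood : KSGood g := ⟨hg0, hgi, hg2,
    (ks_ent_lsc hf hmass hg0 hgm hgi hg2 hgM hw (c := C) (Frequently.of_forall hH)).1⟩
  set C₁ := C + 2 * (3 * (M + B) + ∫ x, ksw x) with hC₁
  have ha : ∀ n, (∫ x, |f n x * Real.log (f n x)|) ≤ C₁ := by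
    intro n
    have h1 := (hf n).abs_ent_le
    rw [hmass n] at h1
    linarith [hH n, hm2 n]
  have hC₁0 : 0 ≤ C₁ := (integral_nonneg fun x => abs_nonneg _).trans (ha 0)
  apply le_of_forall_pos_le_add
  intro η hη
  set c := liminf (fun n => freeEnergy (f n)) atTop + η / 2 with hc
  have hfr : ∃ᶠ n in atTop, freeEnergy (f n) < c := by
    apply frequently_lt_of_liminf_lt
    · exact IsBounded.isCobounded_ge (isBoundedUnder_of ⟨A, hF⟩)
    · linarith
  set δ := η / 6 * (4 * π) with hδ
  have hδ0 : 0 < δ := by positivity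
  obtain ⟨e, he, hshort⟩ := ks_short_unif hM.1 hC₁0 hδ0
  obtain ⟨N, hN⟩ := hgood.trunc he hδ0
  have hcont : Continuous (fun q : KSE × KSE => min (ksL e (q.1 - q.2)) N) :=
    ((ksL_cont he).comp (by fun_prop)).min continuous_const
  have hbd : ∀ q : KSE × KSE, |min (ksL e (q.1 - q.2)) N| ≤ max |N| |Real.log e| := by
    intro q
    have h1 : Real.log e ≤ ksL e (q.1 - q.2) := Real.log_le_log he (le_max_right _ _)
    have h2 := le_max_left |N| |Real.log e|
    have h3 := le_max_right |N| |Real.log e|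
    rw [abs_le]
    constructor
    · apply le_min
      · linarith [neg_abs_le (Real.log e)]
      · linarith [neg_abs_le N]
    · exact (min_le_right _ _).trans ((le_abs_self N).trans h2)
  have hlim := ks_prod_weak hM.1 (fun n => (hf n).nonneg) (fun n => (hf n).int) hmass hg0 hgi hgM
    (fun ψ hψ C hC => hw ψ hψ C fun x => (hC x).trans (by
      have : 0 ≤ C := (abs_nonneg _).trans (hC 0)
      nlinarith [norm_nonneg x])) hcont hbd
  set Dg := ∫ q : KSE × KSE, g q.1 * g q.2 * min (ksL e (q.1 - q.2)) N with hDg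
  have hev := hlim.eventually (lt_mem_nhds (show Dg - δ < Dg by linarith))
  have hfr2 : ∃ᶠ n in atTop, (∫ x, f n x * Real.log (f n x)) ≤
      c - 1 / (4 * π) * (Dg - 2 * δ) := by
    refine (hfr.and_eventually hev).mono fun n hn => ?_
    obtain ⟨h1, h2⟩ := hn
    have h3 := hshort (f n) (hf n) (hmass n) (ha n) N
    unfold freeEnergy at h1
    have h4 : Dg - 2 * δ ≤ ∫ q : KSE × KSE, f n q.1 * f n q.2 * Real.log ‖q.1 - q.2‖ := by
      linarith
    have h5 := mul_le_mul_of_nonneg_left h4 (by positivity : 0 ≤ 1 / (4 * π))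
    linarith
  have hfin := (ks_ent_lsc hf hmass hg0 hgm hgi hg2 hgM hw hfr2).2
  have h6 := mul_le_mul_of_nonneg_left hN (by positivity : 0 ≤ 1 / (4 * π))
  have h7 : 1 / (4 * π) * δ = η / 6 := by rw [hδ]; field_simp
  have hgE : freeEnergy g = (∫ x, g x * Real.log (g x)) + 1 / (4 * π) *
      ∫ q : KSE × KSE, g q.1 * g q.2 * Real.log ‖q.1 - q.2‖ := rfl
  rw [hgE]
  have h8 : 1 / (4 * π) * (Dg - 2 * δ) = 1 / (4 * π) * Dg - 2 * (η / 6) := by rw [← h7]; ring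
  have h9 : 1 / (4 * π) * (Dg + δ) = 1 / (4 * π) * Dg + η / 6 := by rw [← h7]; ring
  rw [h8] at hfin
  rw [h9] at h6
  linarith

/-- Lower semicontinuity of the free energy along distributionally convergent
sequences of mass `M < 8π` with uniformly bounded second moments and free energy:
the limit `f` is nonnegative, has mass `M`, finite second moment, and
`F(f) ≤ liminf F(f_n)`. -/
theorem free_energy_lsc (M : ℝ) (hM : M ∈ Set.Ioo 0 (8 * π))
    (f : ℕ → EuclideanSpace ℝ (Fin 2) → ℝ)
    (flim : EuclideanSpace ℝ (Fin 2) → ℝ) (A : ℝ)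
    (hpos : ∀ n x, 0 ≤ f n x)
    (hint : ∀ n, Integrable (f n))
    (hmass : ∀ n, (∫ x, f n x) = M)
    (hm2int : ∀ n, Integrable (fun x => f n x * ‖x‖ ^ 2))
    (hm2 : ∃ B : ℝ, ∀ n, (∫ x, f n x * ‖x‖ ^ 2) ≤ B)
    (hent : ∀ n, Integrable (fun x => f n x * |Real.log (f n x)|))
    (hdbl : ∀ n, Integrable
      (fun q : EuclideanSpace ℝ (Fin 2) × EuclideanSpace ℝ (Fin 2) =>
        f n q.1 * f n q.2 * |Real.log ‖q.1 - q.2‖|))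
    (hF : ∀ n, freeEnergy (f n) ≤ A)
    (hmeas : Measurable flim)
    (hconv : ∀ φ : EuclideanSpace ℝ (Fin 2) → ℝ,
      ContDiff ℝ (⊤ : ℕ∞) φ → HasCompactSupport φ →
      Tendsto (fun n => ∫ x, f n x * φ x) atTop (nhds (∫ x, flim x * φ x))) :
    (∀ᵐ x, 0 ≤ flim x) ∧ Integrable flim ∧ (∫ x, flim x) = M ∧
      Integrable (fun x => flim x * ‖x‖ ^ 2) ∧
      freeEnergy flim ≤ liminf (fun n => freeEnergy (f n)) atTop := by
  obtain ⟨B, hB⟩ := hm2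
  have hloc : LocallyIntegrable flim := ks_locint hM.1 hpos hint hmass hm2int hB hconv
  have hae0 : ∀ᵐ x, 0 ≤ flim x := ks_nonneg hpos hloc hconv
  set g : KSE → ℝ := fun x => max (flim x) 0 with hg
  have hgm : Measurable g := hmeas.max measurable_const
  have hg0 : ∀ x, 0 ≤ g x := fun x => le_max_right _ _
  have hfg : flim =ᵐ[volume] g := by
    filter_upwards [hae0] with x hx
    exact (max_eq_left hx).symm
  have hconv' : ∀ φ : KSE → ℝ, ContDiff ℝ (⊤ : ℕ∞) φ → HasCompactSupport φ →
      Tendsto (fun n => ∫ x, f n x * φ x) atTop (nhds (∫ x, g x * φ x)) := by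
    intro φ h1 h2
    have e : ∫ x, g x * φ x = ∫ x, flim x * φ x := by
      apply integral_congr_ae
      filter_upwards [hfg] with x hx
      rw [hx]
    rw [e]
    exact hconv φ h1 h2
  have hlocg : LocallyIntegrable g := ks_locint hM.1 hpos hint hmass hm2int hB hconv'
  obtain ⟨hgi, hg2⟩ := ks_moments hpos hint hmass hm2int hB hconv' hlocg hg0
  have hw : ∀ ψ : KSE → ℝ, Continuous ψ → ∀ C : ℝ, (∀ x, |ψ x| ≤ C * (1 + ‖x‖)) →
      Tendsto (fun n => ∫ x, f n x * ψ x) atTop (nhds (∫ x, g x * ψ x)) :=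
    fun ψ hψ C hC => ks_weak hpos hint (fun n => (hmass n).le) hm2int hB hconv' hg0 hgi hg2 hψ hC
  have hgM : ∫ x, g x = M := by
    have h1 := hw (fun _ => 1) continuous_const 1 (fun x => by
      rw [abs_one]; linarith [norm_nonneg x])
    simp only [mul_one, hmass] at h1
    exact tendsto_nhds_unique h1 tendsto_const_nhds
  have hgood : ∀ n, KSGood (f n) := by
    intro n
    refine ⟨hpos n, hint n, hm2int n, ?_⟩
    refine (hent n).mono ?_ (Eventually.of_forall fun x => ?_)
    · exact (hint n).aestronglyMeasurable.mul
        (hint n).aemeasurable.log.aestronglyMeasurable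
    · simp only [norm_mul, Real.norm_eq_abs, abs_abs]
      exact le_rfl
  have hmain := ks_main hM hgood hmass hB hF hg0 hgm hgi hg2 hgM hw
  refine ⟨hae0, hgi.congr hfg.symm, ?_, ?_, ?_⟩
  · rw [integral_congr_ae hfg]; exact hgM
  · refine hg2.congr ?_
    filter_upwards [hfg] with x hx
    rw [hx]
  · have e : freeEnergy flim = freeEnergy g := by
      unfold freeEnergy
      congr 1
      · apply integral_congr_ae
        filter_upwards [hfg] with x hx
        rw [hx]
      · congr 1
        apply integral_congr_ae
        have h1 : ∀ᵐ q : KSE × KSE, flim q.1 = g q.1 :=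
          Measure.quasiMeasurePreserving_fst.ae hfg
        have h2 : ∀ᵐ q : KSE × KSE, flim q.2 = g q.2 :=
          Measure.quasiMeasurePreserving_snd.ae hfg
        filter_upwards [h1, h2] with q hq1 hq2
        rw [hq1, hq2]
    rw [e]
    exact hmain
end
end

section
/- For every M ∈ (0, 8π) there exists a constant C₇ = C₇(M) such that every nonnegative integrable function g on ℝ² with ∫_{ℝ²} g dx = M, finite second moment, ∫ g |log g| dx < ∞ and ∬ g(x) g(y) |log|x−y|| dx dy < ∞ satisfies ∫_{ℝ²} g (log g)₊ dx + (1/4) ∫_{ℝ²} g(x) |x|² dx ≤ (1 − M/(8π))^{−1} · E(g) + C₇, where E(g) := ∫_{ℝ²} g (1 + log g) dx + (1/2) ∫_{ℝ²} g(x) |x|² dx + (1/(4π)) ∬_{ℝ²×ℝ²} g(x) g(y) log|x−y| dx dy. -/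
open MeasureTheory Real

noncomputable section

/-- The coupling kernel on the unit interval. -/
def KK (u v w : ℝ) : ℝ :=
  if 0 < u ∧ u < 1 ∧ 0 < v ∧ v < 1 ∧ ((u < w ∧ w < v) ∨ (v < w ∧ w < u)) then
    π * sin (π * u) * sin (π * v) / (|sin (π * (v - u))| * sin (π * w) ^ 2)
  else 0

lemma sin_pi_pos {u : ℝ} (h0 : 0 < u) (h1 : u < 1) : 0 < sin (π * u) :=
  sin_pos_of_pos_of_lt_pi (by positivity) (by nlinarith [pi_pos])

lemma KK_nonneg (u v w : ℝ) : 0 ≤ KK u v w := by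
  unfold KK
  split_ifs with h
  · have := sin_pi_pos h.1 h.2.1
    have := sin_pi_pos h.2.2.1 h.2.2.2.1
    positivity
  · exact le_rfl

lemma KK_symm (u v w : ℝ) : KK u v w = KK v u w := by
  unfold KK
  have : |sin (π * (v - u))| = |sin (π * (u - v))| := by
    rw [← abs_neg, ← sin_neg]; congr 2; ring
  rw [this]
  split_ifs with h1 h2 h2
  · ring
  · exact absurd (by tauto) h2
  · exact absurd (by tauto) h1
  · rfl

lemma KK_measurable : Measurable (fun q : (ℝ × ℝ) × ℝ => KK q.1.1 q.1.2 q.2) := by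
  unfold KK
  refine Measurable.ite ?_ (by fun_prop) measurable_const
  have a1 : Measurable (fun q : (ℝ × ℝ) × ℝ => q.1.1) := by fun_prop
  have a2 : Measurable (fun q : (ℝ × ℝ) × ℝ => q.1.2) := by fun_prop
  have a3 : Measurable (fun q : (ℝ × ℝ) × ℝ => q.2) := by fun_prop
  exact (measurableSet_lt measurable_const a1).inter <|
    (measurableSet_lt a1 measurable_const).inter <|
    (measurableSet_lt measurable_const a2).inter <|
    (measurableSet_lt a2 measurable_const).inter <|
    ((measurableSet_lt a1 a3).inter (measurableSet_lt a3 a2)).union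
    ((measurableSet_lt a2 a3).inter (measurableSet_lt a3 a1))

/-- lintegral over an interval through the fundamental theorem of calculus -/
lemma lint_Ioo {f F : ℝ → ℝ} {a b : ℝ} (hab : a ≤ b)
    (hd : ∀ x ∈ Set.Icc a b, HasDerivAt F (f x) x) (hc : ContinuousOn f (Set.Icc a b))
    (h0 : ∀ x ∈ Set.Icc a b, 0 ≤ f x) :
    ∫⁻ x in Set.Ioo a b, ENNReal.ofReal (f x) = ENNReal.ofReal (F b - F a) := by
  have hi : IntervalIntegrable f volume a b := by
    apply ContinuousOn.intervalIntegrable; rwa [Set.uIcc_of_le hab]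
  have hI := intervalIntegral.integral_eq_sub_of_hasDerivAt (a := a) (b := b) (f := F) (f' := f)
    (by rwa [Set.uIcc_of_le hab]) hi
  rw [intervalIntegral.integral_of_le hab, integral_Ioc_eq_integral_Ioo] at hI
  rw [← hI, ofReal_integral_eq_lintegral_ofReal]
  · exact (hi.1).mono_set Set.Ioo_subset_Ioc_self
  · exact (ae_restrict_iff' measurableSet_Ioo).2
      (Filter.Eventually.of_forall fun x hx => h0 x (Set.Ioo_subset_Icc_self hx))

lemma KK_int_w_aux {u v : ℝ} (hu : 0 < u) (hv : v < 1) (huv : u < v) :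
    ∫⁻ w in Set.Ioo (0:ℝ) 1, ENNReal.ofReal (KK u v w) = 1 := by
  set c := π * sin (π * u) * sin (π * v) / sin (π * (v - u)) with hc
  have su := sin_pi_pos hu (huv.trans hv)
  have sv := sin_pi_pos (hu.trans huv) hv
  have sd := sin_pi_pos (u := v - u) (by linarith) (by linarith)
  have e : (fun w => ENNReal.ofReal (KK u v w)) =
      (Set.Ioo u v).indicator (fun w => ENNReal.ofReal (c / sin (π * w) ^ 2)) := by
    ext w
    by_cases hw : w ∈ Set.Ioo u v
    · rw [Set.indicator_of_mem hw, KK, if_pos ⟨hu, huv.trans hv, hu.trans huv, hv, Or.inl hw⟩,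
        abs_of_pos sd, hc, div_div]
    · rw [Set.indicator_of_notMem hw, KK, if_neg, ENNReal.ofReal_zero]
      rintro ⟨-, -, -, -, h | h⟩
      · exact hw h
      · linarith
  rw [e, lintegral_indicator measurableSet_Ioo, Measure.restrict_restrict measurableSet_Ioo,
    Set.inter_eq_left.2 (Set.Ioo_subset_Ioo hu.le hv.le)]
  rw [lint_Ioo (F := fun w => - (c / π) * (cos (π * w) / sin (π * w))) huv.le]
  · have : sin (π * (v - u)) = sin (π * v) * cos (π * u) - cos (π * v) * sin (π * u) := by
      rw [mul_sub, sin_sub]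
    have h1 : -(c / π) * (cos (π * v) / sin (π * v)) - -(c / π) * (cos (π * u) / sin (π * u)) = 1 := by
      rw [hc]
      have := pi_pos
      field_simp
      linarith
    rw [h1, ENNReal.ofReal_one]
  · intro x hx
    have sx := sin_pi_pos (hu.trans_le hx.1) (hx.2.trans_lt hv)
    have hl : HasDerivAt (fun w : ℝ => π * w) π x := by
      simpa using (hasDerivAt_id x).const_mul π
    have := (((hl.cos).div hl.sin sx.ne').const_mul (-(c/π)))
    refine HasDerivAt.congr_deriv this ?_
    have := pi_pos
    field_simp
    linear_combination c * sin_sq_add_cos_sq (π * x)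
  · intro x hx
    have sx := sin_pi_pos (hu.trans_le hx.1) (hx.2.trans_lt hv)
    apply ContinuousAt.continuousWithinAt
    have : sin (π * x) ^ 2 ≠ 0 := by positivity
    fun_prop (disch := assumption)
  · intro x hx
    positivity

lemma KK_int_w {u v : ℝ} (hu : 0 < u) (hu1 : u < 1) (hv : 0 < v) (hv1 : v < 1) (huv : u ≠ v) :
    ∫⁻ w in Set.Ioo (0:ℝ) 1, ENNReal.ofReal (KK u v w) = 1 := by
  rcases lt_or_gt_of_ne huv with h | h
  · exact KK_int_w_aux hu hv1 h
  · simp_rw [KK_symm u v]; exact KK_int_w_aux hv hu1 h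

lemma KK_zero {u v w : ℝ} (h : ¬ (0 < u ∧ u < 1 ∧ 0 < v ∧ v < 1)) : KK u v w = 0 := by
  rw [KK, if_neg]; tauto

lemma KK_shift {d w : ℝ} (hd : 0 < d) (hd1 : d < 1) (hw : 0 < w) (hw1 : w < 1) :
    (∫⁻ u, ENNReal.ofReal (KK u (u + d) w)) + (∫⁻ u, ENNReal.ofReal (KK u (u + (d - 1)) w)) = 1 := by
  have sd := sin_pi_pos hd hd1
  have sw := sin_pi_pos hw hw1
  have hpi := pi_pos
  set c := π / (sin (π * d) * sin (π * w) ^ 2) with hc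
  have hc0 : 0 < c := by positivity
  set Q : ℝ → ℝ := fun u => c * (u * cos (π * d) / 2 - sin (2 * π * u + π * d) / (4 * π)) with hQ
  have hder : ∀ x, HasDerivAt Q (c * (sin (π * x) * sin (π * (x + d)))) x := by
    intro x
    have hl : HasDerivAt (fun w : ℝ => 2 * π * w + π * d) (2 * π) x := by
      simpa using ((hasDerivAt_id x).const_mul (2 * π)).add_const (π * d)
    have := ((((hasDerivAt_id x).mul_const (cos (π * d))).div_const 2).sub
      (hl.sin.div_const (4 * π))).const_mul c
    refine HasDerivAt.congr_deriv this ?_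
    have e1 : cos (π * d) = cos (π * (x + d)) * cos (π * x) + sin (π * (x + d)) * sin (π * x) := by
      rw [← cos_sub]; congr 1; ring
    have e2 : cos (2 * π * x + π * d) = cos (π * (x + d)) * cos (π * x) - sin (π * (x + d)) * sin (π * x) := by
      rw [← cos_add]; congr 1; ring
    rw [e1, e2]
    field_simp
    ring
  have sneg : ∀ x, sin (π * (x + (d - 1))) = - sin (π * (x + d)) := by
    intro x
    rw [← sin_sub_pi]; congr 1; ring
  have e1 : (fun u => ENNReal.ofReal (KK u (u + d) w)) =
      (Set.Ioo (max 0 (w - d)) (min w (1 - d))).indicator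
        (fun u => ENNReal.ofReal (c * (sin (π * u) * sin (π * (u + d))))) := by
    ext u
    by_cases hu : u ∈ Set.Ioo (max 0 (w - d)) (min w (1 - d))
    · rw [Set.indicator_of_mem hu]
      obtain ⟨h1, h2⟩ := hu
      rw [max_lt_iff] at h1
      rw [lt_min_iff] at h2
      rw [KK, if_pos ⟨h1.1, by linarith, by linarith, by linarith, Or.inl ⟨h2.1, by linarith⟩⟩]
      rw [show u + d - u = d by ring, abs_of_pos sd, hc]
      congr 1
      ring
    · rw [Set.indicator_of_notMem hu, KK, if_neg, ENNReal.ofReal_zero]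
      rintro ⟨a1, a2, a3, a4, h | h⟩
      · exact hu ⟨max_lt a1 (by linarith), lt_min h.1 (by linarith)⟩
      · linarith
  have e2 : (fun u => ENNReal.ofReal (KK u (u + (d - 1)) w)) =
      (Set.Ioo (max w (1 - d)) (1 + min 0 (w - d))).indicator
        (fun u => ENNReal.ofReal (-(c * (sin (π * u) * sin (π * (u + d)))))) := by
    ext u
    by_cases hu : u ∈ Set.Ioo (max w (1 - d)) (1 + min 0 (w - d))
    · rw [Set.indicator_of_mem hu]
      obtain ⟨h1, h2⟩ := hu
      rw [max_lt_iff] at h1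
      have h2' : u < 1 ∧ u < 1 + (w - d) :=
        ⟨by linarith [min_le_left 0 (w - d)], by linarith [min_le_right 0 (w - d)]⟩
      rw [KK, if_pos ⟨by linarith, by linarith, by linarith, by linarith, Or.inr ⟨by linarith, h1.1⟩⟩]
      have : |sin (π * (u + (d - 1) - u))| = sin (π * d) := by
        have : sin (π * (u + (d - 1) - u)) = - sin (π * d) := by
          have := sneg 0
          rw [zero_add, zero_add] at this
          rw [← this]; congr 1; ring
        rw [this, abs_neg, abs_of_pos sd]
      rw [this, sneg, hc]
      congr 1
      ring
    · rw [Set.indicator_of_notMem hu, KK, if_neg, ENNReal.ofReal_zero]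
      rintro ⟨a1, a2, a3, a4, h | h⟩
      · linarith
      · refine hu ⟨max_lt h.2 (by linarith), ?_⟩
        rcases min_choice 0 (w - d) with h' | h' <;> rw [h'] <;> linarith
  have le1 : max 0 (w - d) ≤ min w (1 - d) :=
    max_le (le_min hw.le (by linarith)) (le_min (by linarith) (by linarith))
  have le2 : max w (1 - d) ≤ 1 + min 0 (w - d) := by
    rcases min_choice 0 (w - d) with h' | h' <;> rw [h'] <;> apply max_le <;> linarith
  have p1 : ∀ x ∈ Set.Icc (max 0 (w - d)) (min w (1 - d)), 0 ≤ c * (sin (π * x) * sin (π * (x + d))) := by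
    rintro x ⟨h1, h2⟩
    rw [max_le_iff] at h1
    rw [le_min_iff] at h2
    have a1 : 0 ≤ sin (π * x) := sin_nonneg_of_nonneg_of_le_pi (by nlinarith) (by nlinarith)
    have a2 : 0 ≤ sin (π * (x + d)) := sin_nonneg_of_nonneg_of_le_pi (by nlinarith) (by nlinarith)
    positivity
  have p2 : ∀ x ∈ Set.Icc (max w (1 - d)) (1 + min 0 (w - d)),
      0 ≤ -(c * (sin (π * x) * sin (π * (x + d)))) := by
    rintro x ⟨h1, h2⟩
    rw [max_le_iff] at h1
    have h2' : x ≤ 1 ∧ x ≤ 1 + (w - d) :=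
        ⟨by linarith [min_le_left 0 (w - d)], by linarith [min_le_right 0 (w - d)]⟩
    have a1 : 0 ≤ sin (π * x) := sin_nonneg_of_nonneg_of_le_pi (by nlinarith) (by nlinarith)
    have a2 : 0 ≤ sin (π * (x + (d - 1))) := sin_nonneg_of_nonneg_of_le_pi (by nlinarith) (by nlinarith)
    rw [sneg] at a2
    have : 0 ≤ c * (sin (π * x) * (- sin (π * (x + d)))) := by positivity
    linarith
  rw [e1, e2, lintegral_indicator measurableSet_Ioo, lintegral_indicator measurableSet_Ioo,
    lint_Ioo (F := Q) le1 (fun x _ => hder x) (by fun_prop) p1,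
    lint_Ioo (F := fun x => - Q x) le2 (fun x _ => (hder x).neg) (by fun_prop) p2]
  have mono1 : 0 ≤ Q (min w (1 - d)) - Q (max 0 (w - d)) := by
    have : MonotoneOn Q (Set.Icc (max 0 (w - d)) (min w (1 - d))) := by
      apply monotoneOn_of_deriv_nonneg (convex_Icc _ _)
        (fun x _ => (hder x).continuousAt.continuousWithinAt)
        (fun x _ => (hder x).differentiableAt.differentiableWithinAt)
      intro x hx
      rw [(hder x).deriv]
      exact p1 x (interior_subset hx)
    have := this (Set.left_mem_Icc.2 le1) (Set.right_mem_Icc.2 le1) le1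
    linarith
  have mono2 : 0 ≤ - Q (1 + min 0 (w - d)) - - Q (max w (1 - d)) := by
    have : MonotoneOn (fun x => - Q x) (Set.Icc (max w (1 - d)) (1 + min 0 (w - d))) := by
      apply monotoneOn_of_deriv_nonneg (convex_Icc _ _)
        (fun x _ => (hder x).neg.continuousAt.continuousWithinAt)
        (fun x _ => (hder x).neg.differentiableAt.differentiableWithinAt)
      intro x hx
      rw [(hder x).neg.deriv]
      exact p2 x (interior_subset hx)
    have := this (Set.left_mem_Icc.2 le2) (Set.right_mem_Icc.2 le2) le2
    simp only at this
    linarith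
  rw [← ENNReal.ofReal_add mono1 mono2]
  have q1 : Q (min w (1 - d)) + Q (max w (1 - d)) = Q w + Q (1 - d) := by
    rcases le_total w (1 - d) with h | h
    · rw [min_eq_left h, max_eq_right h]
    · rw [min_eq_right h, max_eq_left h]; ring
  have q3 : ∀ x, Q (1 + x) = Q x + c * cos (π * d) / 2 := by
    intro x
    simp only [hQ]
    rw [show 2 * π * (1 + x) + π * d = 2 * π * x + π * d + 2 * π by ring, sin_add_two_pi]
    ring
  have q2 : Q (max 0 (w - d)) + Q (min 0 (w - d)) = Q 0 + Q (w - d) := by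
    rcases le_total 0 (w - d) with h | h
    · rw [min_eq_left h, max_eq_right h]; ring
    · rw [min_eq_right h, max_eq_left h]
  have fin : Q w + Q (1 - d) - Q 0 - Q (w - d) - c * cos (π * d) / 2 = 1 := by
    simp only [hQ]
    have s1 : sin (2 * π * (1 - d) + π * d) = - sin (π * d) := by
      rw [← sin_neg, ← sin_add_two_pi (-(π * d))]; congr 1; ring
    have s2 : sin (2 * π * w + π * d) - sin (2 * π * (w - d) + π * d)
        = 2 * cos (2 * (π * w)) * sin (π * d) := by
      rw [show 2 * π * w + π * d = 2 * (π * w) + π * d by ring,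
        show 2 * π * (w - d) + π * d = 2 * (π * w) - π * d by ring, sin_add, sin_sub]
      ring
    rw [cos_two_mul, cos_sq'] at s2
    rw [s1, mul_zero, zero_add]
    have : sin (2 * π * w + π * d) = sin (2 * π * (w - d) + π * d) + 2 * (2 * (1 - sin (π * w) ^ 2) - 1) * sin (π * d) := by
      linarith
    rw [this, hc]
    field_simp
    ring
  have : Q (min w (1 - d)) - Q (max 0 (w - d)) + (- Q (1 + min 0 (w - d)) - - Q (max w (1 - d))) = 1 := by
    rw [q3]; linarith
  rw [this, ENNReal.ofReal_one]

lemma KK_int_uv {w : ℝ} (hw : 0 < w) (hw1 : w < 1) :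
    ∫⁻ u in Set.Ioo (0:ℝ) 1, ∫⁻ v in Set.Ioo (0:ℝ) 1, ENNReal.ofReal (KK u v w) = 1 := by
  have hm : Measurable (fun q : ℝ × ℝ => ENNReal.ofReal (KK q.1 q.2 w)) := by
    have : Measurable (fun q : ℝ × ℝ => ((q.1, q.2), w)) := by fun_prop
    exact (KK_measurable.comp this).ennreal_ofReal
  have hm' : Measurable (fun q : ℝ × ℝ => ENNReal.ofReal (KK q.2 (q.2 + q.1) w)) := by
    have : Measurable (fun q : ℝ × ℝ => (q.2, q.2 + q.1)) := by fun_prop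
    exact hm.comp this
  have s1 : ∀ u, ∫⁻ v in Set.Ioo (0:ℝ) 1, ENNReal.ofReal (KK u v w) = ∫⁻ v, ENNReal.ofReal (KK u v w) := by
    intro u
    apply setLIntegral_eq_of_support_subset
    intro v hv
    by_contra h
    apply hv
    simp only [Set.mem_Ioo] at h
    simp only
    rw [KK_zero (by tauto), ENNReal.ofReal_zero]
  simp_rw [s1]
  have s2 : ∫⁻ u in Set.Ioo (0:ℝ) 1, ∫⁻ v, ENNReal.ofReal (KK u v w) =
      ∫⁻ u, ∫⁻ v, ENNReal.ofReal (KK u v w) := by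
    apply setLIntegral_eq_of_support_subset
    intro v hv
    by_contra h
    apply hv
    simp only [Set.mem_Ioo] at h
    have : ∀ x, KK v x w = 0 := fun x => KK_zero (by tauto)
    simp [this]
  rw [s2]
  have s3 : ∀ u, ∫⁻ v, ENNReal.ofReal (KK u v w) = ∫⁻ d, ENNReal.ofReal (KK u (u + d) w) := fun u =>
    (lintegral_add_left_eq_self (fun v => ENNReal.ofReal (KK u v w)) u).symm
  simp_rw [s3]
  rw [lintegral_lintegral_swap (by
    have : Measurable (fun q : ℝ × ℝ => (q.2, q.1)) := by fun_prop
    exact (hm'.comp this).aemeasurable)]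
  set A : ℝ → ENNReal := fun d => ∫⁻ u, ENNReal.ofReal (KK u (u + d) w) with hA
  have hAm : Measurable A := hm'.lintegral_prod_right'
  have s4 : ∫⁻ d, A d = ∫⁻ d in Set.Ioc (-1:ℝ) 1, A d := by
    symm
    apply setLIntegral_eq_of_support_subset
    intro d hd
    by_contra h
    apply hd
    have : ∀ u, KK u (u + d) w = 0 := by
      intro u
      apply KK_zero
      rintro ⟨a, b, c, e⟩
      exact h ⟨by linarith, by linarith⟩
    simp [hA, this]
  have s5 : ∫⁻ d in Set.Ioc (-1:ℝ) 0, A d = ∫⁻ d in Set.Ioc (0:ℝ) 1, A (d - 1) := by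
    have := lintegral_sub_right_eq_self (μ := (volume : Measure ℝ))
      (fun d => (Set.Ioc (-1:ℝ) 0).indicator A d) 1
    rw [lintegral_indicator measurableSet_Ioc] at this
    rw [← this, ← lintegral_indicator measurableSet_Ioc]
    congr 1
    ext d
    by_cases h : d ∈ Set.Ioc (0:ℝ) 1
    · rw [Set.indicator_of_mem h, Set.indicator_of_mem]
      exact ⟨by linarith [h.1], by linarith [h.2]⟩
    · rw [Set.indicator_of_notMem h, Set.indicator_of_notMem]
      intro h'
      exact h ⟨by linarith [h'.1], by linarith [h'.2]⟩
  change ∫⁻ d, A d = 1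
  rw [s4, ← Set.Ioc_union_Ioc_eq_Ioc (show (-1:ℝ) ≤ 0 by norm_num) (show (0:ℝ) ≤ 1 by norm_num),
    lintegral_union measurableSet_Ioc (Set.Ioc_disjoint_Ioc_of_le le_rfl), s5,
    ← lintegral_add_left (by fun_prop), ← restrict_Ioo_eq_restrict_Ioc]
  rw [setLIntegral_congr_fun (g := fun _ => 1) measurableSet_Ioo]
  · simp
  · intro d hd
    simp only
    rw [add_comm]
    exact KK_shift hd.1 hd.2 hw hw1

open ProbabilityTheory in
lemma cdf_continuous (μ : Measure ℝ) [IsProbabilityMeasure μ] [NullSingletonClass μ] :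
    Continuous (cdf μ) := by
  rw [continuous_iff_continuousAt]
  intro x
  rw [(monotone_cdf μ).continuousAt_iff_leftLim_eq_rightLim, StieltjesFunction.rightLim_eq]
  have h := (cdf μ).measure_singleton x
  rw [measure_cdf, measure_singleton] at h
  have h1 := (ENNReal.ofReal_eq_zero.1 h.symm)
  have h2 := (monotone_cdf μ).leftLim_le (le_refl x)
  linarith

open ProbabilityTheory in
lemma map_cdf (μ : Measure ℝ) [IsProbabilityMeasure μ] [NullSingletonClass μ] :
    μ.map (cdf μ) = volume.restrict (Set.Ioo (0:ℝ) 1) := by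
  have hc := cdf_continuous μ
  have hm : Measurable (cdf μ) := hc.measurable
  have : IsFiniteMeasure (μ.map (cdf μ)) := by infer_instance
  have ivt : ∀ t : ℝ, 0 < t → t < 1 → ∃ x, cdf μ x = t := by
    intro t h0 h1
    have a := ((tendsto_cdf_atBot μ).eventually (eventually_le_nhds h0)).exists
    have b := ((tendsto_cdf_atTop μ).eventually (eventually_ge_nhds h1)).exists
    exact mem_range_of_exists_le_of_exists_ge hc a b
  apply Measure.ext_of_Iic
  intro t
  rw [Measure.map_apply hm measurableSet_Iic, Measure.restrict_apply measurableSet_Iic]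
  rcases lt_or_ge t 0 with h0 | h0
  · have e1 : (cdf μ) ⁻¹' Set.Iic t = ∅ := by
      ext x; simp; linarith [cdf_nonneg μ x]
    have e2 : Set.Iic t ∩ Set.Ioo (0:ℝ) 1 = ∅ := by
      ext x; simp; intro h h'; linarith
    rw [e1, e2]; simp
  rcases le_or_gt 1 t with h1 | h1
  · have e1 : (cdf μ) ⁻¹' Set.Iic t = Set.univ := by
      ext x; simp; linarith [cdf_le_one μ x]
    have e2 : Set.Iic t ∩ Set.Ioo (0:ℝ) 1 = Set.Ioo (0:ℝ) 1 := by
      ext x; simp; intro h h'; linarith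
    rw [e1, e2]; simp
  have e2 : Set.Iic t ∩ Set.Ioo (0:ℝ) 1 = Set.Ioc (0:ℝ) t := by
    ext x; simp
    constructor
    · rintro ⟨a, b, c⟩; exact ⟨b, a⟩
    · rintro ⟨a, b⟩; exact ⟨b, a, by linarith⟩
  rw [e2, Real.volume_Ioc, sub_zero]
  apply le_antisymm
  · have : ∀ s ∈ Set.Ioo t 1, μ (cdf μ ⁻¹' Set.Iic t) ≤ ENNReal.ofReal s := by
      intro s hs
      obtain ⟨x, hx⟩ := ivt s (by linarith [hs.1]) hs.2
      rw [← hx, ofReal_cdf]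
      apply measure_mono
      intro y hy
      by_contra hxy
      have := monotone_cdf μ (not_le.1 hxy).le
      have hy' : cdf μ y ≤ t := hy
      linarith [hs.1]
    have hcont : Filter.Tendsto (fun s : ℝ => ENNReal.ofReal s) (nhdsWithin t (Set.Ioi t))
        (nhds (ENNReal.ofReal t)) :=
      (ENNReal.continuous_ofReal.tendsto t).mono_left nhdsWithin_le_nhds
    refine ge_of_tendsto hcont ?_
    filter_upwards [Ioo_mem_nhdsGT h1] with s hs using this s hs
  · rcases h0.eq_or_lt with rfl | h0
    · simp
    obtain ⟨x, hx⟩ := ivt t h0 h1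
    rw [← hx, ofReal_cdf]
    apply measure_mono
    intro y hy
    exact monotone_cdf μ hy

lemma log_sin_integrable :
    Integrable (fun w => log (sin (π * w))) (volume.restrict (Set.Ioo (0:ℝ) 1)) := by
  have h := (intervalIntegrable_log_sin (a := 0) (b := π)).comp_mul_left (c := π)
  simp only [zero_div, div_self pi_ne_zero] at h
  rw [intervalIntegrable_iff_integrableOn_Ioo_of_le zero_le_one] at h
  exact h

lemma log_sin_integrable' (u : ℝ) :
    IntervalIntegrable (fun v => log (sin (π * (u - v)))) volume 0 1 := by
  have h := (intervalIntegrable_log_sin (a := π * u) (b := π * u - π)).comp_mul_left (c := π)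
  have h2 := h.comp_sub_left u
  have e1 : u - π * u / π = 0 := by have := pi_ne_zero; field_simp; ring
  have e2 : u - (π * u - π) / π = 1 := by have := pi_ne_zero; field_simp; ring
  rw [e1, e2] at h2
  exact h2

lemma log_sin_integrable2 :
    Integrable (fun q : ℝ × ℝ => log (sin (π * (q.1 - q.2))))
      ((volume.restrict (Set.Ioo (0:ℝ) 1)).prod (volume.restrict (Set.Ioo (0:ℝ) 1))) := by
  have hm : Measurable (fun q : ℝ × ℝ => log (sin (π * (q.1 - q.2)))) := by fun_prop
  rw [integrable_prod_iff hm.aestronglyMeasurable]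
  have per : Function.Periodic (fun v => ‖log (sin (π * v))‖) 1 := by
    intro v
    simp only
    rw [mul_add, mul_one, sin_add_pi, log_neg_eq_log]
  refine ⟨Filter.Eventually.of_forall fun u => ?_, ?_⟩
  · have := log_sin_integrable' u
    rw [intervalIntegrable_iff_integrableOn_Ioo_of_le zero_le_one] at this
    exact this
  · have : ∀ u : ℝ, ∫ v in Set.Ioo (0:ℝ) 1, ‖log (sin (π * (u - v)))‖ =
        ∫ v in (0:ℝ)..1, ‖log (sin (π * v))‖ := by
      intro u
      rw [← integral_Ioc_eq_integral_Ioo, ← intervalIntegral.integral_of_le zero_le_one,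
        intervalIntegral.integral_comp_sub_left (fun v => ‖log (sin (π * v))‖)]
      have := per.intervalIntegral_add_eq (u - 1) 0
      simpa using this
    simp_rw [this]
    exact integrable_const _

lemma integrable_of_lint_one {α : Type*} [MeasurableSpace α] {μ : Measure α} {f : α → ℝ}
    (hm : Measurable f) (h0 : ∀ x, 0 ≤ f x) (h1 : ∫⁻ x, ENNReal.ofReal (f x) ∂μ = 1) :
    Integrable f μ ∧ ∫ x, f x ∂μ = 1 := by
  constructor
  · refine ⟨hm.aestronglyMeasurable, ?_⟩
    rw [hasFiniteIntegral_iff_ofReal (Filter.Eventually.of_forall h0), h1]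
    exact ENNReal.one_lt_top
  · rw [integral_eq_lintegral_of_nonneg_ae (Filter.Eventually.of_forall h0)
      hm.aestronglyMeasurable, h1]
    simp

lemma ae_pair_unit : ∀ᵐ q ∂((volume.restrict (Set.Ioo (0:ℝ) 1)).prod
      (volume.restrict (Set.Ioo (0:ℝ) 1))), q.1 ∈ Set.Ioo (0:ℝ) 1 ∧ q.2 ∈ Set.Ioo (0:ℝ) 1 ∧ q.1 ≠ q.2 := by
  have h1 : ∀ᵐ x ∂(volume.restrict (Set.Ioo (0:ℝ) 1)), x ∈ Set.Ioo (0:ℝ) 1 :=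
    ae_restrict_mem measurableSet_Ioo
  have a := Measure.quasiMeasurePreserving_fst (μ := volume.restrict (Set.Ioo (0:ℝ) 1))
    (ν := volume.restrict (Set.Ioo (0:ℝ) 1)) |>.ae h1
  have b := Measure.quasiMeasurePreserving_snd (μ := volume.restrict (Set.Ioo (0:ℝ) 1))
    (ν := volume.restrict (Set.Ioo (0:ℝ) 1)) |>.ae h1
  have c : ∀ᵐ q ∂((volume.restrict (Set.Ioo (0:ℝ) 1)).prod
      (volume.restrict (Set.Ioo (0:ℝ) 1))), q.1 ≠ q.2 := by
    have hs : MeasurableSet {q : ℝ × ℝ | q.1 = q.2} := measurableSet_eq_fun measurable_fst measurable_snd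
    have := (Measure.measure_prod_null (μ := volume.restrict (Set.Ioo (0:ℝ) 1))
      (ν := volume.restrict (Set.Ioo (0:ℝ) 1)) hs).2 (by
        refine Filter.Eventually.of_forall fun u => ?_
        have : Prod.mk u ⁻¹' {q : ℝ × ℝ | q.1 = q.2} = {u} := by
          ext x; simp [eq_comm]
        simp only
        rw [this]; simp)
    rw [ae_iff]
    simpa using this
  filter_upwards [a, b, c] with q h1 h2 h3 using ⟨h1, h2, h3⟩

/-- elementary entropy inequality -/
lemma young (a b : ℝ) (ha : 0 ≤ a) (hb : 0 < b) : a * log b ≤ a * log a - a + b := by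
  rcases ha.eq_or_lt with rfl | ha
  · simp; exact hb.le
  have h := log_le_sub_one_of_pos (div_pos hb ha)
  rw [log_div hb.ne' ha.ne'] at h
  have := mul_le_mul_of_nonneg_left h ha.le
  have e : a * (b / a - 1) = b - a := by field_simp
  rw [e] at this
  linarith

open ProbabilityTheory in
lemma oneD_aux (μ : Measure ℝ) [IsProbabilityMeasure μ] (ρ : ℝ → NNReal)
    (hρ : Measurable ρ) (hμ : μ = volume.withDensity (fun x => (ρ x : ENNReal)))
    (r : ℝ → ℝ) (hr : ∀ x, (ρ x : ℝ) ≤ r x)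
    (x y : ℝ) (hx : cdf μ x ∈ Set.Ioo (0:ℝ) 1) (hy : cdf μ y ∈ Set.Ioo (0:ℝ) 1)
    (hne : cdf μ x ≠ cdf μ y)
    (hK : Integrable (fun w => KK (cdf μ x) (cdf μ y) (cdf μ w)) μ)
    (hK1 : ∫ w, KK (cdf μ x) (cdf μ y) (cdf μ w) ∂μ = 1)
    (hKh : Integrable (fun w => KK (cdf μ x) (cdf μ y) (cdf μ w) *
      (log (r w) - 2 * log (sin (π * cdf μ w)))) μ) :
    log (sin (π * (cdf μ x - cdf μ y))) - log π - ∫ w, KK (cdf μ x) (cdf μ y) (cdf μ w) *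
      (log (r w) - 2 * log (sin (π * cdf μ w))) ∂μ ≤ log |x - y| := by
  set F := cdf μ with hFdef
  set S := log (sin (π * (F x - F y))) with hS
  set L := |x - y| with hL
  have hL0 : 0 < L := by
    apply abs_pos.2; intro h; apply hne; rw [sub_eq_zero.1 h]
  set I := Set.Ioo (min x y) (max x y) with hI
  have hIv : volume I = ENNReal.ofReal L := by
    rw [hI, Real.volume_Ioo, hL, max_sub_min_eq_abs']
  have sx := sin_pi_pos hx.1 hx.2
  have sy := sin_pi_pos hy.1 hy.2
  have key : ∀ w, (ρ w : ℝ) * (KK (F x) (F y) (F w) * (S - log π) - KK (F x) (F y) (F w) *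
      (log (r w) - 2 * log (sin (π * F w)))) ≤
      (ρ w : ℝ) * (KK (F x) (F y) (F w) * (log L - 1)) + I.indicator (fun _ => L⁻¹) w := by
    intro w
    have hind : 0 ≤ I.indicator (fun _ => L⁻¹) w := Set.indicator_nonneg (fun _ _ => by positivity) w
    rcases (ρ w).2.eq_or_lt with h0 | h0
    · have h0 : (ρ w : ℝ) = 0 := h0.symm
      rw [h0]; simpa using hind
    have h0 : 0 < (ρ w : ℝ) := h0
    by_cases hc : 0 < F x ∧ F x < 1 ∧ 0 < F y ∧ F y < 1 ∧ ((F x < F w ∧ F w < F y) ∨ (F y < F w ∧ F w < F x))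
    swap
    · have : KK (F x) (F y) (F w) = 0 := by rw [KK, if_neg hc]
      rw [this]; simpa using hind
    have hKe : KK (F x) (F y) (F w) = π * sin (π * F x) * sin (π * F y) / (|sin (π * (F y - F x))| * sin (π * F w) ^ 2) := by
      rw [KK, if_pos hc]
    have hw : w ∈ I := by
      have mono := monotone_cdf μ
      rcases hc.2.2.2.2 with h | h
      · have h1 := mono.reflect_lt h.1
        have h2 := mono.reflect_lt h.2
        exact ⟨(min_le_left _ _).trans_lt h1, h2.trans_le (le_max_right _ _)⟩
      · have h1 := mono.reflect_lt h.1
        have h2 := mono.reflect_lt h.2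
        exact ⟨(min_le_right _ _).trans_lt h1, h2.trans_le (le_max_left _ _)⟩
    have sw : 0 < sin (π * F w) := by
      apply sin_pi_pos <;> rcases hc.2.2.2.2 with h | h <;> linarith [hc.1, hc.2.1, hc.2.2.1, hc.2.2.2.1, h.1, h.2]
    have sd : 0 < |sin (π * (F y - F x))| := by
      rcases lt_or_gt_of_ne hne with h | h
      · exact abs_pos.2 (sin_pi_pos (by linarith) (by linarith [hc.1, hc.2.2.2.1])).ne'
      · have := sin_pi_pos (u := F x - F y) (by linarith) (by linarith [hc.2.1, hc.2.2.1])
        rw [show π * (F y - F x) = -(π * (F x - F y)) by ring, sin_neg, abs_neg]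
        exact abs_pos.2 this.ne'
    have hSe : S = log |sin (π * (F y - F x))| := by
      rw [hS, log_abs, ← log_neg_eq_log, ← sin_neg]; congr 2; ring
    have hKpos : 0 < KK (F x) (F y) (F w) := by
      rw [hKe]; have := pi_pos; positivity
    have hlogK : log (KK (F x) (F y) (F w)) = log π + log (sin (π * F x)) + log (sin (π * F y)) - S - 2 * log (sin (π * F w)) := by
      rw [hKe, log_div (by have := pi_pos; positivity) (by positivity), log_mul (by have := pi_pos; positivity) (by positivity),
        log_mul pi_ne_zero (by positivity), log_mul (by positivity) (by positivity), log_pow, hSe]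
      push_cast; ring
    set k := KK (F x) (F y) (F w)
    have l1 : log (sin (π * F x)) ≤ 0 := log_nonpos sx.le (sin_le_one _)
    have l2 : log (sin (π * F y)) ≤ 0 := log_nonpos sy.le (sin_le_one _)
    have l3 : log (ρ w) ≤ log (r w) := log_le_log h0 (hr w)
    have hy := young (ρ w * k) (L⁻¹) (by positivity) (by positivity)
    rw [log_inv, log_mul h0.ne' hKpos.ne', hlogK] at hy
    rw [Set.indicator_of_mem hw]
    have hpk : 0 < (ρ w : ℝ) * k := by positivity
    have : (ρ w : ℝ) * k * (log (ρ w) + (log π + log (sin (π * F x)) + log (sin (π * F y)) - S - 2 * log (sin (π * F w)))) ≤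
      (ρ w : ℝ) * k * (log (r w) + log π - S - 2 * log (sin (π * F w))) := by
      apply mul_le_mul_of_nonneg_left _ hpk.le
      linarith
    nlinarith [this, hy]
  have i1 : Integrable (fun w => KK (F x) (F y) (F w) * (S - log π) - KK (F x) (F y) (F w) *
      (log (r w) - 2 * log (sin (π * F w)))) μ := (hK.mul_const _).sub hKh
  have i2 : Integrable (fun w => KK (F x) (F y) (F w) * (log L - 1)) μ := hK.mul_const _
  have v1 : ∫ w, (KK (F x) (F y) (F w) * (S - log π) - KK (F x) (F y) (F w) *
      (log (r w) - 2 * log (sin (π * F w)))) ∂μ = S - log π - ∫ w, KK (F x) (F y) (F w) *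
      (log (r w) - 2 * log (sin (π * F w))) ∂μ := by
    rw [integral_sub (hK.mul_const _) hKh, integral_mul_const, hK1, one_mul]
  have v2 : ∫ w, KK (F x) (F y) (F w) * (log L - 1) ∂μ = log L - 1 := by
    rw [integral_mul_const, hK1, one_mul]
  have i1' := i1
  have i2' := i2
  have tr : ∀ f : ℝ → ℝ, ∫ w, f w ∂μ = ∫ w, (ρ w : ℝ) * f w := by
    intro f
    conv_lhs => rw [hμ]
    rw [integral_withDensity_eq_integral_smul hρ]
    rfl
  have ti : ∀ f : ℝ → ℝ, Integrable f μ → Integrable (fun w => (ρ w : ℝ) * f w) := by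
    intro f hf
    rw [hμ, integrable_withDensity_iff_integrable_smul hρ] at hf
    exact hf
  rw [tr] at v1 v2
  have j3 : Integrable (I.indicator (fun _ => L⁻¹)) := by
    rw [integrable_indicator_iff measurableSet_Ioo]
    apply integrableOn_const
    · rw [← hI, hIv]; exact ENNReal.ofReal_ne_top
    · simp
  have v3 : ∫ w, I.indicator (fun _ => L⁻¹) w = 1 := by
    rw [integral_indicator measurableSet_Ioo, setIntegral_const, ← hI, Measure.real, hIv,
      ENNReal.toReal_ofReal hL0.le, smul_eq_mul, mul_inv_cancel₀ hL0.ne']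
  have fin := integral_mono (ti _ i1) ((ti _ i2).add j3) key
  simp only [Pi.add_apply] at fin
  rw [integral_add (ti _ i2) j3, v1, v2, v3] at fin
  linarith

open ProbabilityTheory in
lemma oneD : ∃ C0 : ℝ, ∀ (μ : Measure ℝ) [IsProbabilityMeasure μ] (ρ : ℝ → NNReal)
    (_ : Measurable ρ) (_ : μ = volume.withDensity (fun x => (ρ x : ENNReal)))
    (r : ℝ → ℝ) (_ : ∀ x, (ρ x : ℝ) ≤ r x) (_ : ∀ x, 0 < r x) (_ : Measurable r)
    (_ : Integrable (fun x => log (r x)) μ),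
    ∃ Λ : ℝ × ℝ → ℝ, Integrable Λ (μ.prod μ) ∧ (∀ᵐ q ∂(μ.prod μ), q.1 ≠ q.2 ∧ Λ q ≤ log |q.1 - q.2|) ∧
      -C0 - ∫ x, log (r x) ∂μ ≤ ∫ q, Λ q ∂(μ.prod μ) := by
  set U := volume.restrict (Set.Ioo (0:ℝ) 1) with hU
  refine ⟨-(∫ q, log (sin (π * (q.1 - q.2))) ∂(U.prod U)) + log π - 2 * ∫ w, log (sin (π * w)) ∂U, ?_⟩
  intro μ hprob ρ hρ hμ r hr hr0 hrm hri
  have hna : NullSingletonClass μ := by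
    rw [hμ]; infer_instance
  set F := cdf μ with hFdef
  have hFm : Measurable F := (cdf_continuous μ).measurable
  have mp : MeasurePreserving F μ U := ⟨hFm, map_cdf μ⟩
  have mp2 : MeasurePreserving (Prod.map F F) (μ.prod μ) (U.prod U) := mp.prod mp
  set h : ℝ → ℝ := fun w => log (r w) - 2 * log (sin (π * F w)) with hh
  have hls : Integrable (fun w => log (sin (π * F w))) μ :=
    mp.integrable_comp_of_integrable log_sin_integrable
  have hls_v : ∫ w, log (sin (π * F w)) ∂μ = ∫ w, log (sin (π * w)) ∂U := by
    rw [← mp.map_eq, integral_map hFm.aemeasurable]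
    exact (by fun_prop : Measurable fun w => log (sin (π * w))).aestronglyMeasurable
  have hhi : Integrable h μ := hri.sub (hls.const_mul 2)
  have hhm : Measurable h := by
    have := hrm.log
    fun_prop
  have hhv : ∫ w, h w ∂μ = ∫ w, log (r w) ∂μ - 2 * ∫ w, log (sin (π * w)) ∂U := by
    rw [hh, integral_sub hri (hls.const_mul 2), integral_const_mul, hls_v]
  have hll : Integrable (fun q : ℝ × ℝ => log (sin (π * (F q.1 - F q.2)))) (μ.prod μ) :=
    mp2.integrable_comp_of_integrable log_sin_integrable2
  have hll_v : ∫ q, log (sin (π * (F q.1 - F q.2))) ∂(μ.prod μ) =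
      ∫ q, log (sin (π * (q.1 - q.2))) ∂(U.prod U) := by
    rw [← mp2.map_eq, integral_map mp2.measurable.aemeasurable]
    · rfl
    · exact (by fun_prop : Measurable fun q : ℝ × ℝ => log (sin (π * (q.1 - q.2)))).aestronglyMeasurable
  set KF : (ℝ × ℝ) × ℝ → ℝ := fun q => KK (F q.1.1) (F q.1.2) (F q.2) with hKF
  have hKFm : Measurable KF := by
    have : Measurable (fun q : (ℝ × ℝ) × ℝ => ((F q.1.1, F q.1.2), F q.2)) := by fun_prop
    exact KK_measurable.comp this
  have fibw : ∀ w, F w ∈ Set.Ioo (0:ℝ) 1 → Integrable (fun q => KF (q, w)) (μ.prod μ) ∧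
      ∫ q, KF (q, w) ∂(μ.prod μ) = 1 := by
    intro w hw
    apply integrable_of_lint_one (hKFm.comp (by fun_prop : Measurable fun q : ℝ × ℝ => (q, w))) (fun q => KK_nonneg _ _ _)
    have m : Measurable (fun q : ℝ × ℝ => ENNReal.ofReal (KK q.1 q.2 (F w))) := by
      have : Measurable (fun q : ℝ × ℝ => ((q.1, q.2), F w)) := by fun_prop
      exact (KK_measurable.comp this).ennreal_ofReal
    have := mp2.lintegral_comp m
    refine Eq.trans this ?_
    rw [lintegral_prod _ m.aemeasurable]
    exact KK_int_uv hw.1 hw.2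
  have fibq : ∀ q : ℝ × ℝ, F q.1 ∈ Set.Ioo (0:ℝ) 1 → F q.2 ∈ Set.Ioo (0:ℝ) 1 → F q.1 ≠ F q.2 →
      Integrable (fun w => KF (q, w)) μ ∧ ∫ w, KF (q, w) ∂μ = 1 := by
    intro q h1 h2 h3
    apply integrable_of_lint_one (hKFm.comp (by fun_prop : Measurable fun w : ℝ => (q, w))) (fun w => KK_nonneg _ _ _)
    have m : Measurable (fun w : ℝ => ENNReal.ofReal (KK (F q.1) (F q.2) w)) := by
      have : Measurable (fun w : ℝ => ((F q.1, F q.2), w)) := by fun_prop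
      exact (KK_measurable.comp this).ennreal_ofReal
    have := mp.lintegral_comp m
    refine Eq.trans this ?_
    exact KK_int_w h1.1 h1.2 h2.1 h2.2 h3
  have aew : ∀ᵐ w ∂μ, F w ∈ Set.Ioo (0:ℝ) 1 :=
    mp.quasiMeasurePreserving.ae (ae_restrict_mem measurableSet_Ioo)
  have aeq := mp2.quasiMeasurePreserving.ae ae_pair_unit
  have hG : Integrable (fun q : (ℝ × ℝ) × ℝ => KF q * h q.2) ((μ.prod μ).prod μ) := by
    have hm : Measurable (fun q : (ℝ × ℝ) × ℝ => KF q * h q.2) := by fun_prop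
    rw [integrable_prod_iff' hm.aestronglyMeasurable]
    constructor
    · filter_upwards [aew] with w hw
      exact (fibw w hw).1.mul_const _
    · apply hhi.norm.congr
      filter_upwards [aew] with w hw
      have : ∀ q, ‖KF (q, w) * h w‖ = KF (q, w) * ‖h w‖ := by
        intro q
        rw [norm_mul, Real.norm_of_nonneg (KK_nonneg _ _ _)]
      simp_rw [this]
      rw [integral_mul_const, (fibw w hw).2, one_mul]
  have hGv : ∫ q, ∫ w, KF (q, w) * h w ∂μ ∂(μ.prod μ) = ∫ w, h w ∂μ := by
    rw [integral_integral_swap (f := fun q w => KF (q, w) * h w) hG]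
    apply integral_congr_ae
    filter_upwards [aew] with w hw
    rw [integral_mul_const, (fibw w hw).2, one_mul]
  have hGi : Integrable (fun q => ∫ w, KF (q, w) * h w ∂μ) (μ.prod μ) := hG.integral_prod_left
  refine ⟨fun q => log (sin (π * (F q.1 - F q.2))) - log π - ∫ w, KF (q, w) * h w ∂μ, ?_, ?_, ?_⟩
  · exact (hll.sub (integrable_const _)).sub hGi
  · filter_upwards [aeq, hG.prod_right_ae] with q hq hq2
    obtain ⟨h1, h2, h3⟩ := hq
    obtain ⟨f1, f2⟩ := fibq q h1 h2 h3
    refine ⟨fun h => h3 (congrArg F h), ?_⟩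
    exact oneD_aux μ ρ hρ hμ r hr q.1 q.2 h1 h2 h3 f1 f2 hq2
  · have i3 : Integrable (fun q : ℝ × ℝ => log (sin (π * (F q.1 - F q.2))) - log π) (μ.prod μ) :=
      hll.sub (integrable_const _)
    simp only
    rw [integral_sub i3 hGi, integral_sub hll (integrable_const _), hGv, hhv, hll_v]
    simp
    linarith

abbrev E2 := EuclideanSpace ℝ (Fin 2)

lemma meas_coord (i : Fin 2) : Measurable (fun x : E2 => x i) := by fun_prop

lemma marg (P : Measure E2) [IsProbabilityMeasure P] (hP : P ≪ volume) (i : Fin 2) :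
    ∃ ρ : ℝ → NNReal, Measurable ρ ∧
      P.map (fun x => x i) = volume.withDensity (fun t => (ρ t : ENNReal)) ∧
      Integrable (fun t => (ρ t : ℝ)) ∧ ∫ t, (ρ t : ℝ) = 1 := by
  have hprob : IsProbabilityMeasure (P.map (fun x : E2 => x i)) :=
    Measure.isProbabilityMeasure_map (meas_coord i).aemeasurable
  have hq : Measure.QuasiMeasurePreserving (fun x : E2 => x i) volume volume :=
    (Measure.quasiMeasurePreserving_eval (fun _ : Fin 2 => (volume : Measure ℝ)) i).comp
      (PiLp.volume_preserving_ofLp (Fin 2)).quasiMeasurePreserving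
  have hac : P.map (fun x : E2 => x i) ≪ volume :=
    (hP.map (meas_coord i)).trans hq.absolutelyContinuous
  set ν := P.map (fun x : E2 => x i) with hν
  refine ⟨fun t => (ν.rnDeriv volume t).toNNReal, (Measure.measurable_rnDeriv _ _).ennreal_toNNReal,
    ?_, Measure.integrable_toReal_rnDeriv, ?_⟩
  · conv_lhs => rw [← Measure.withDensity_rnDeriv_eq ν volume hac]
    apply withDensity_congr_ae
    filter_upwards [Measure.rnDeriv_ne_top ν volume] with t ht
    rw [ENNReal.coe_toNNReal ht]
  · have := Measure.integral_toReal_rnDeriv hac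
    simpa [ENNReal.toReal] using this

lemma prodInt (a b : ℝ → ℝ) (ha : Integrable a) (hb : Integrable b) :
    Integrable (fun x : E2 => a (x 0) * b (x 1)) ∧
      ∫ x : E2, a (x 0) * b (x 1) = (∫ t, a t) * ∫ t, b t := by
  have mp := PiLp.volume_preserving_ofLp (Fin 2)
  have h1 : Integrable (fun y : Fin 2 → ℝ => a (y 0) * b (y 1)) := by
    have := Integrable.fintype_prod (f := ![a, b]) (μ := fun _ : Fin 2 => (volume : Measure ℝ))
      (by intro i; fin_cases i <;> simpa)
    simp only [Fin.prod_univ_two, Matrix.cons_val_zero, Matrix.cons_val_one] at this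
    exact this
  refine ⟨mp.integrable_comp_of_integrable h1, ?_⟩
  have h2 := integral_fintype_prod_volume_eq_prod (fun i : Fin 2 => (![a, b] : Fin 2 → ℝ → ℝ) i)
  simp only [Fin.prod_univ_two, Matrix.cons_val_zero, Matrix.cons_val_one] at h2
  rw [← h2]
  have h3 := mp.integral_comp (MeasurableEquiv.toLp 2 (Fin 2 → ℝ)).symm.measurableEmbedding
    (fun y : Fin 2 → ℝ => a (y 0) * b (y 1))
  exact h3

lemma coord_sq_le (x : E2) (i : Fin 2) : x i ^ 2 ≤ ‖x‖ ^ 2 := by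
  rw [EuclideanSpace.norm_sq_eq, Fin.sum_univ_two]
  simp only [Real.norm_eq_abs, sq_abs]
  fin_cases i <;> simp <;> positivity

lemma neg_log_gam (t : ℝ) : -t ^ 2 ≤ log ((1 + t ^ 2)⁻¹) := by
  rw [Real.log_inv]
  have := Real.log_le_sub_one_of_pos (show 0 < 1 + t ^ 2 by positivity)
  linarith

lemma logr_int (p : E2 → ℝ) (hp0 : ∀ x, 0 ≤ p x) (hp : Integrable p)
    (hp2 : Integrable (fun x => p x * ‖x‖ ^ 2)) (hpl : Integrable (fun x => p x * log (p x)))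
    (r : ℝ → ℝ) (hr : Measurable r) (hri : Integrable r) (hrl : ∀ t, (1 + t ^ 2)⁻¹ ≤ r t)
    (i : Fin 2) : Integrable (fun x => p x * log (r (x i))) := by
  obtain ⟨j, hj, hint⟩ : ∃ j : Fin 2, j ≠ i ∧
      Integrable (fun x : E2 => r (x i) * (1 + x j ^ 2)⁻¹) := by
    fin_cases i
    · exact ⟨1, by simp, (prodInt r _ hri integrable_inv_one_add_sq).1⟩
    · refine ⟨0, by simp, ?_⟩
      have := (prodInt _ r integrable_inv_one_add_sq hri).1
      simpa [mul_comm] using this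
  have hb : Integrable (fun x => |p x * log (p x)| + p x + r (x i) * (1 + x j ^ 2)⁻¹
      + p x * ‖x‖ ^ 2) := ((hpl.abs.add hp).add hint).add hp2
  refine hb.mono' ?_ ?_
  · exact hp.1.mul (hr.comp (meas_coord i)).log.aestronglyMeasurable
  · refine Filter.Eventually.of_forall fun x => ?_
    have hg : 0 < (1 + x i ^ 2)⁻¹ := by positivity
    have hgj : 0 < (1 + x j ^ 2)⁻¹ := by positivity
    have hrp : 0 < r (x i) := hg.trans_le (hrl _)
    have h1 := young (p x) (r (x i) * (1 + x j ^ 2)⁻¹) (hp0 x) (by positivity)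
    rw [Real.log_mul hrp.ne' hgj.ne'] at h1
    have h2 := mul_le_mul_of_nonneg_left (neg_log_gam (x j)) (hp0 x)
    have h3 := mul_le_mul_of_nonneg_left (neg_log_gam (x i)) (hp0 x)
    have h4 := mul_le_mul_of_nonneg_left (coord_sq_le x i) (hp0 x)
    have h5 := mul_le_mul_of_nonneg_left (coord_sq_le x j) (hp0 x)
    have h6 := mul_le_mul_of_nonneg_left (Real.log_le_log hg (hrl (x i))) (hp0 x)
    have h7 := le_abs_self (p x * log (p x))
    have h8 := abs_nonneg (p x * log (p x))
    have h9 : 0 < r (x i) * (1 + x j ^ 2)⁻¹ := by positivity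
    have := hp0 x
    rw [Real.norm_eq_abs, abs_le]
    constructor <;> nlinarith

lemma log_norm_ge (x y : E2) (h0 : x 0 ≠ y 0) (h1 : x 1 ≠ y 1) :
    log 2 + log |x 0 - y 0| + log |x 1 - y 1| ≤ 2 * log ‖x - y‖ := by
  have a0 : 0 < |x 0 - y 0| := abs_pos.2 (sub_ne_zero.2 h0)
  have a1 : 0 < |x 1 - y 1| := abs_pos.2 (sub_ne_zero.2 h1)
  have hn : ‖x - y‖ ^ 2 = |x 0 - y 0| ^ 2 + |x 1 - y 1| ^ 2 := by
    rw [EuclideanSpace.norm_sq_eq, Fin.sum_univ_two]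
    simp
  rw [← Real.log_mul (by norm_num) a0.ne', ← Real.log_mul (by positivity) a1.ne']
  have : 2 * log ‖x - y‖ = log (‖x - y‖ ^ 2) := by rw [Real.log_pow]; norm_num
  rw [this, hn]
  apply Real.log_le_log (by positivity)
  nlinarith [sq_nonneg (|x 0 - y 0| - |x 1 - y 1|)]

lemma twoD : ∃ C : ℝ, ∀ p : E2 → ℝ, (∀ x, 0 ≤ p x) → Integrable p → ∫ x, p x = 1 →
    Integrable (fun x => p x * ‖x‖ ^ 2) → Integrable (fun x => p x * log (p x)) →
    Integrable (fun q : E2 × E2 => p q.1 * p q.2 * log ‖q.1 - q.2‖) →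
    -C ≤ (∫ x, p x * log (p x)) + 2 * ∫ q : E2 × E2, p q.1 * p q.2 * log ‖q.1 - q.2‖ := by
  obtain ⟨C0, hC⟩ := oneD
  refine ⟨2 * C0 - log 2 + (1 + π) ^ 2 - 1, ?_⟩
  intro p hp0 hp hp1 hp2 hpl hpp
  set pn : E2 → NNReal := fun x => (p x).toNNReal with hpn
  have hpc : ∀ x, (pn x : ℝ) = p x := fun x => Real.coe_toNNReal _ (hp0 x)
  have hpm : AEMeasurable pn := hp.1.aemeasurable.real_toNNReal
  set P : Measure E2 := volume.withDensity (fun x => (pn x : ENNReal)) with hP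
  have hprob : IsProbabilityMeasure P := by
    constructor
    rw [hP, withDensity_apply _ MeasurableSet.univ, Measure.restrict_univ]
    have := ofReal_integral_eq_lintegral_ofReal hp (Filter.Eventually.of_forall hp0)
    rw [hp1, ENNReal.ofReal_one] at this
    exact this.symm
  have hac : P ≪ volume := withDensity_absolutelyContinuous _ _
  have hPint : ∀ f : E2 → ℝ, ∫ x, f x ∂P = ∫ x, p x * f x := by
    intro f
    rw [hP, integral_withDensity_eq_integral_smul₀ hpm]
    simp only [NNReal.smul_def, hpc, smul_eq_mul]
  have hPinteg : ∀ f : E2 → ℝ, Integrable f P ↔ Integrable (fun x => p x * f x) := by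
    intro f
    rw [hP, integrable_withDensity_iff_integrable_smul₀ hpm]
    simp only [NNReal.smul_def, hpc, smul_eq_mul]
  have hPP : P.prod P = (volume : Measure (E2 × E2)).withDensity
      (fun q => ((pn q.1 * pn q.2 : NNReal) : ENNReal)) := by
    rw [hP, prod_withDensity₀ hpm.coe_nnreal_ennreal hpm.coe_nnreal_ennreal]
    simp only [ENNReal.coe_mul]
    rfl
  have hppm : AEMeasurable (fun q : E2 × E2 => pn q.1 * pn q.2) :=
    (hpm.comp_fst (ν := (volume : Measure E2))).mul (hpm.comp_snd (μ := (volume : Measure E2)))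
  have hPPint : ∀ f : E2 × E2 → ℝ, ∫ q, f q ∂(P.prod P) = ∫ q : E2 × E2, p q.1 * p q.2 * f q := by
    intro f
    rw [hPP, integral_withDensity_eq_integral_smul₀ hppm]
    simp only [NNReal.smul_def, NNReal.coe_mul, hpc, smul_eq_mul]
  have hPPinteg : Integrable (fun q : E2 × E2 => log ‖q.1 - q.2‖) (P.prod P) := by
    rw [hPP, integrable_withDensity_iff_integrable_smul₀ hppm]
    simpa only [NNReal.smul_def, NNReal.coe_mul, hpc, smul_eq_mul] using hpp
  choose ρ hρm hρe hρi hρ1 using marg P hac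
  set r : Fin 2 → ℝ → ℝ := fun i t => ρ i t + (1 + t ^ 2)⁻¹ with hr
  have hgam : ∀ t : ℝ, 0 < (1 + t ^ 2)⁻¹ := fun t => by positivity
  have hrpos : ∀ i t, 0 < r i t := fun i t => add_pos_of_nonneg_of_pos (ρ i t).2 (hgam t)
  have hrm : ∀ i, Measurable (r i) := by
    intro i
    have := hρm i
    simp only [hr]
    fun_prop
  have hri : ∀ i, Integrable (r i) := fun i => (hρi i).add integrable_inv_one_add_sq
  have hr1 : ∀ i, ∫ t, r i t = 1 + π := by
    intro i
    simp only [hr]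
    rw [integral_add (hρi i) integrable_inv_one_add_sq, hρ1 i, integral_univ_inv_one_add_sq]
  have hrl : ∀ i t, (1 + t ^ 2)⁻¹ ≤ r i t := fun i t => le_add_of_nonneg_left (ρ i t).2
  have hL : ∀ i, Integrable (fun x => p x * log (r i (x i))) := fun i =>
    logr_int p hp0 hp hp2 hpl (r i) (hrm i) (hri i) (hrl i) i
  have hmp : ∀ i, MeasurePreserving (fun x : E2 => x i) P (P.map (fun x : E2 => x i)) :=
    fun i => ⟨meas_coord i, rfl⟩
  have hmprob : ∀ i, IsProbabilityMeasure (P.map (fun x : E2 => x i)) := fun i =>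
    Measure.isProbabilityMeasure_map (meas_coord i).aemeasurable
  have hlr : ∀ i, Integrable (fun t => log (r i t)) (P.map (fun x : E2 => x i)) := by
    intro i
    rw [integrable_map_measure (hrm i).log.aestronglyMeasurable (meas_coord i).aemeasurable]
    exact (hPinteg _).2 (hL i)
  have hlri : ∀ i, ∫ t, log (r i t) ∂(P.map (fun x : E2 => x i)) = ∫ x, p x * log (r i (x i)) := by
    intro i
    rw [integral_map (meas_coord i).aemeasurable (hrm i).log.aestronglyMeasurable, hPint]
  have hΛ := fun i => hC (P.map (fun x : E2 => x i)) (ρ i) (hρm i) (hρe i) (r i)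
    (fun t => le_add_of_nonneg_right (hgam t).le) (hrpos i) (hrm i) (hlr i)
  choose Λ hΛi hΛle hΛint using hΛ
  have hmp2 : ∀ i, MeasurePreserving (Prod.map (fun x : E2 => x i) (fun x : E2 => x i))
      (P.prod P) ((P.map (fun x : E2 => x i)).prod (P.map (fun x : E2 => x i))) :=
    fun i => (hmp i).prod (hmp i)
  have hΛ2 : ∀ i, Integrable (fun q : E2 × E2 => Λ i (q.1 i, q.2 i)) (P.prod P) := fun i =>
    (hmp2 i).integrable_comp_of_integrable (hΛi i)
  have hΛ2i : ∀ i, ∫ q : E2 × E2, Λ i (q.1 i, q.2 i) ∂(P.prod P) =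
      ∫ q, Λ i q ∂((P.map (fun x : E2 => x i)).prod (P.map (fun x : E2 => x i))) := by
    intro i
    have h := hΛi i
    rw [← (hmp2 i).map_eq] at h ⊢
    rw [integral_map (hmp2 i).measurable.aemeasurable h.1]
    rfl
  have hae : ∀ i, ∀ᵐ q ∂(P.prod P), q.1 i ≠ q.2 i ∧
      Λ i (q.1 i, q.2 i) ≤ log |q.1 i - q.2 i| := fun i =>
    (hmp2 i).quasiMeasurePreserving.ae (hΛle i)
  have hPP1 : IsProbabilityMeasure (P.prod P) := inferInstance
  have key1 : log 2 + (∫ q : E2 × E2, Λ 0 (q.1 0, q.2 0) ∂(P.prod P))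
      + (∫ q : E2 × E2, Λ 1 (q.1 1, q.2 1) ∂(P.prod P)) ≤
      2 * ∫ q : E2 × E2, log ‖q.1 - q.2‖ ∂(P.prod P) := by
    have i1 : Integrable (fun q : E2 × E2 => log 2 + Λ 0 (q.1 0, q.2 0)) (P.prod P) :=
      (integrable_const _).add (hΛ2 0)
    have i2 : Integrable (fun q : E2 × E2 => log 2 + Λ 0 (q.1 0, q.2 0) + Λ 1 (q.1 1, q.2 1))
        (P.prod P) := i1.add (hΛ2 1)
    have e1 : ∫ q : E2 × E2, (log 2 + Λ 0 (q.1 0, q.2 0) + Λ 1 (q.1 1, q.2 1)) ∂(P.prod P) =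
      log 2 + (∫ q : E2 × E2, Λ 0 (q.1 0, q.2 0) ∂(P.prod P))
      + (∫ q : E2 × E2, Λ 1 (q.1 1, q.2 1) ∂(P.prod P)) := by
      rw [integral_add i1 (hΛ2 1),
        integral_add (integrable_const _) (hΛ2 0)]
      simp
    rw [← e1, ← integral_const_mul]
    apply integral_mono_ae i2 (hPPinteg.const_mul 2)
    filter_upwards [hae 0, hae 1] with q h0 h1
    have := log_norm_ge q.1 q.2 h0.1 h1.1
    linarith [h0.2, h1.2]
  rw [hΛ2i 0, hΛ2i 1, hPPint] at key1
  have k0 := hΛint 0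
  have k1 := hΛint 1
  rw [hlri] at k0 k1
  obtain ⟨hrr, hrri⟩ := prodInt (r 0) (r 1) (hri 0) (hri 1)
  rw [hr1, hr1] at hrri
  have key2 : (∫ x, p x * log (r 0 (x 0))) + (∫ x, p x * log (r 1 (x 1))) ≤
      (∫ x, p x * log (p x)) - 1 + (1 + π) * (1 + π) := by
    have i1 : Integrable (fun x => p x * log (p x) - p x) := hpl.sub hp
    rw [← hrri, ← hp1, ← integral_add (hL 0) (hL 1), ← integral_sub hpl hp,
      ← integral_add i1 hrr]
    apply integral_mono ((hL 0).add (hL 1)) (i1.add hrr)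
    intro x
    have := young (p x) (r 0 (x 0) * r 1 (x 1)) (hp0 x) (mul_pos (hrpos _ _) (hrpos _ _))
    rw [Real.log_mul (hrpos _ _).ne' (hrpos _ _).ne'] at this
    simp only [Pi.add_apply, Pi.sub_apply]
    linarith
  linarith

lemma gauss_int : Integrable (fun x : E2 => exp (-(‖x‖ ^ 2 / 4))) := by
  by_contra h
  have h1 := GaussianFourier.integral_rexp_neg_mul_sq_norm (V := E2) (b := 1 / 4) (by norm_num)
  have h2 : (fun x : E2 => exp (-(1 / 4) * ‖x‖ ^ 2)) = fun x : E2 => exp (-(‖x‖ ^ 2 / 4)) := by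
    funext x; congr 1; ring
  rw [h2, integral_undef h] at h1
  have : (0 : ℝ) < (π / (1 / 4)) ^ (Module.finrank ℝ E2 / 2 : ℝ) := by positivity
  linarith

lemma twoDg (M : ℝ) (hM : 0 < M) : ∃ C : ℝ, ∀ g : E2 → ℝ, (∀ x, 0 ≤ g x) → Integrable g →
    ∫ x, g x = M →
    Integrable (fun x => g x * ‖x‖ ^ 2) → Integrable (fun x => g x * log (g x)) →
    Integrable (fun q : E2 × E2 => g q.1 * g q.2 * log ‖q.1 - q.2‖) →
    -C ≤ (∫ x, g x * log (g x)) +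
      2 / M * ∫ q : E2 × E2, g q.1 * g q.2 * log ‖q.1 - q.2‖ := by
  obtain ⟨C, hC⟩ := twoD
  refine ⟨M * C - M * log M, ?_⟩
  intro g h0 hg hg1 hg2 hgl hgg
  have e1 : (fun x => M⁻¹ * g x * log (M⁻¹ * g x)) =
      fun x => M⁻¹ * (g x * log (g x)) - M⁻¹ * log M * g x := by
    funext x
    rcases eq_or_ne (g x) 0 with h | h
    · simp [h]
    · rw [Real.log_mul (by positivity) h, Real.log_inv]; ring
  have e2 : (fun q : E2 × E2 => M⁻¹ * g q.1 * (M⁻¹ * g q.2) * log ‖q.1 - q.2‖) =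
      fun q : E2 × E2 => M⁻¹ ^ 2 * (g q.1 * g q.2 * log ‖q.1 - q.2‖) := by
    funext q; ring
  have h := hC (fun x => M⁻¹ * g x) (fun x => mul_nonneg (by positivity) (h0 x))
    (hg.const_mul _) (by rw [integral_const_mul, hg1]; field_simp)
    (by simpa [mul_assoc] using hg2.const_mul M⁻¹)
    (by rw [e1]; exact (hgl.const_mul _).sub (hg.const_mul _))
    (by rw [e2]; exact hgg.const_mul _)
  simp only [e1, e2] at h
  rw [integral_sub (hgl.const_mul _) (hg.const_mul _), integral_const_mul, integral_const_mul,
    integral_const_mul, hg1] at h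
  have h3 := mul_le_mul_of_nonneg_left h hM.le
  have e3 : ∀ A B : ℝ, M * (M⁻¹ * A - M⁻¹ * log M * M + 2 * (M⁻¹ ^ 2 * B)) =
      A + 2 / M * B - M * log M := by
    intro A B; field_simp; ring
  rw [e3] at h3
  linarith

theorem rescaled_free_energy_bound (M : ℝ) (hM0 : 0 < M) (hM : M < 8 * π) :
    ∃ C₇ : ℝ,
      ∀ g : EuclideanSpace ℝ (Fin 2) → ℝ,
        (∀ x, 0 ≤ g x) → Integrable g → (∫ x, g x) = M →
        Integrable (fun x => g x * ‖x‖ ^ 2) →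
        Integrable (fun x => g x * |Real.log (g x)|) →
        Integrable (fun q : EuclideanSpace ℝ (Fin 2) × EuclideanSpace ℝ (Fin 2) =>
          g q.1 * g q.2 * |Real.log ‖q.1 - q.2‖|) →
        (∫ x, g x * max (Real.log (g x)) 0) + (1 / 4) * (∫ x, g x * ‖x‖ ^ 2) ≤
          (1 - M / (8 * π))⁻¹ *
            ((∫ x, g x * (1 + Real.log (g x))) +
              (1 / 2) * (∫ x, g x * ‖x‖ ^ 2) +
              (1 / (4 * π)) *
                ∫ q : EuclideanSpace ℝ (Fin 2) × EuclideanSpace ℝ (Fin 2),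
                  g q.1 * g q.2 * Real.log ‖q.1 - q.2‖) + C₇ := by
  obtain ⟨C, hC⟩ := twoDg M hM0
  have hpi := Real.pi_pos
  obtain ⟨θ, hθ⟩ : ∃ θ, θ = M / (8 * π) := ⟨_, rfl⟩
  have hθ0 : 0 < θ := by rw [hθ]; positivity
  have hθ1 : θ < 1 := by rw [hθ, div_lt_one (by positivity)]; exact hM
  have hθM : θ * (2 / M) = 1 / (4 * π) := by rw [hθ]; field_simp; norm_num
  obtain ⟨G, hG⟩ : ∃ G, G = ∫ x : E2, exp (-(‖x‖ ^ 2 / 4)) := ⟨_, rfl⟩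
  refine ⟨(1 - θ)⁻¹ * (θ * C - M) + G, ?_⟩
  intro g h0 hg hg1 hg2 hgl' hgg'
  rw [← hθ, ← hθM]
  have hgm := hg.1.aemeasurable
  have hgl : Integrable (fun x => g x * log (g x)) := by
    refine hgl'.mono' (hgm.mul hgm.log).aestronglyMeasurable (Filter.Eventually.of_forall fun x => ?_)
    rw [Real.norm_eq_abs, abs_mul, abs_of_nonneg (h0 x)]
  have hgm2 : AEMeasurable (fun q : E2 × E2 => g q.1 * g q.2) :=
    (hgm.comp_fst (ν := (volume : Measure E2))).mul (hgm.comp_snd (μ := (volume : Measure E2)))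
  have hgg : Integrable (fun q : E2 × E2 => g q.1 * g q.2 * log ‖q.1 - q.2‖) := by
    refine hgg'.mono' (hgm2.mul ?_).aestronglyMeasurable (Filter.Eventually.of_forall fun q => ?_)
    · exact (Measurable.log (by fun_prop)).aemeasurable
    · rw [Real.norm_eq_abs, abs_mul, abs_of_nonneg (mul_nonneg (h0 _) (h0 _))]
  have hmax : Integrable (fun x => g x * max (log (g x)) 0) := by
    refine hgl'.mono' (hgm.mul (hgm.log.max aemeasurable_const)).aestronglyMeasurable
      (Filter.Eventually.of_forall fun x => ?_)
    rw [Real.norm_eq_abs, abs_mul, abs_of_nonneg (h0 x)]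
    refine mul_le_mul_of_nonneg_left ?_ (h0 x)
    rw [abs_of_nonneg (le_max_right _ _)]
    exact max_le (le_abs_self _) (abs_nonneg _)
  have k1 := hC g h0 hg hg1 hg2 hgl hgg
  have k2 : ∫ x, g x * (1 + log (g x)) = M + ∫ x, g x * log (g x) := by
    simp only [mul_add, mul_one]
    rw [integral_add hg hgl, hg1]
  have k3 : (∫ x, g x * max (log (g x)) 0) ≤
      (∫ x, g x * log (g x)) + (1 / 4) * (∫ x, g x * ‖x‖ ^ 2) + G := by
    have i1 : Integrable (fun x => g x * log (g x) + 1 / 4 * (g x * ‖x‖ ^ 2)) :=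
      hgl.add (hg2.const_mul _)
    rw [hG, ← integral_const_mul, ← integral_add hgl (hg2.const_mul _),
      ← integral_add i1 gauss_int]
    apply integral_mono hmax (i1.add gauss_int)
    intro x
    have hx := h0 x
    have he := Real.exp_pos (-(‖x‖ ^ 2 / 4))
    have hn : 0 ≤ g x * ‖x‖ ^ 2 := by positivity
    simp only [Pi.add_apply]
    rcases le_total (log (g x)) 0 with h | h
    · rw [max_eq_right h]
      have := young (g x) (exp (-(‖x‖ ^ 2 / 4))) hx he
      rw [Real.log_exp] at this
      linarith
    · rw [max_eq_left h]
      linarith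
  have k4 : 0 ≤ ∫ x, g x * ‖x‖ ^ 2 :=
    integral_nonneg fun x => mul_nonneg (h0 x) (by positivity)
  rw [k2]
  generalize (∫ x, g x * max (log (g x)) 0) = X at *
  generalize (∫ x, g x * log (g x)) = A at *
  generalize (∫ x, g x * ‖x‖ ^ 2) = B at *
  generalize (∫ q : E2 × E2, g q.1 * g q.2 * log ‖q.1 - q.2‖) = D at *
  have hp : 0 < 1 - θ := by linarith
  have k5 : (1 - θ) * (A + 1 / 2 * B) ≤
      M + A + 1 / 2 * B + θ * (2 / M) * D + (θ * C - M) := by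
    have := mul_le_mul_of_nonneg_left k1 hθ0.le
    nlinarith
  have k6 : A + 1 / 2 * B ≤
      (1 - θ)⁻¹ * (M + A + 1 / 2 * B + θ * (2 / M) * D + (θ * C - M)) := by
    rw [inv_mul_eq_div, le_div_iff₀ hp]
    linarith
  rw [mul_add] at k6
  linarith
end
end
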